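/- arXiv:2107.03514 — 3 statements merged into one kernel-verified Lean document; each statement's English description precedes it below -/
import Mathlib

section
/- Let n ≥ 2 and 1 ≤ k ≤ n be integers and let f be an admissible semitrough profile for (n,k). Define z : ℝⁿ → ℝ by z(x) = √(f(x₁)² + |x̄|²), where x = (x₁, x̄). Then z is smooth and spacelike, i.e. |∇z(x)| < 1 for every x ∈ ℝⁿ, and the image of the gradient map ∇z : ℝⁿ → ℝⁿ is exactly the open half-disc { ξ ∈ ℝⁿ : |ξ| < 1 and ξ₁ > 0 }. -/
open Filter Real

/-- `lk n k = ((n-k)/n)^(1/k)`. -/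
noncomputable def lk (n k : ℕ) : ℝ := (((n : ℝ) - k) / n) ^ ((1 : ℝ) / k)

/-- An admissible semitrough profile for `(n, k)`. -/
def IsAdmissibleProfile (n k : ℕ) (f : ℝ → ℝ) : Prop :=
  ContDiff ℝ 2 f ∧
  (∀ t : ℝ,
      (k : ℝ) * deriv (deriv f) t /
          (f t ^ (k - 1) * (1 - deriv f t ^ 2) ^ ((k : ℝ) / 2 + 1)) +
        ((n : ℝ) - k) / (f t ^ k * (1 - deriv f t ^ 2) ^ ((k : ℝ) / 2)) = n) ∧
  (∀ t : ℝ, 0 < deriv f t ∧ deriv f t < 1 ∧ 0 < deriv (deriv f) t) ∧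
  Tendsto f atBot (nhds (lk n k)) ∧
  (∀ t : ℝ, max (lk n k) t < f t ∧ f t < Real.sqrt (1 + t ^ 2)) ∧
  (∃ C > (0 : ℝ), ∃ T > (0 : ℝ), ∀ t > T,
      |f t - Real.sqrt (1 + t ^ 2)| < C * t ^ (-(n : ℝ) - 1))

/-- The semitrough height function `z(x) = √(f(x₁)² + |x̄|²)`. -/
noncomputable def zfun (n : ℕ) [NeZero n] (f : ℝ → ℝ) (x : EuclideanSpace ℝ (Fin n)) : ℝ :=
  Real.sqrt (f (x 0) ^ 2 + ∑ i ∈ Finset.univ.erase (0 : Fin n), x i ^ 2)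

/-- The growth bounds at both ends force the slope of a positive function above the diagonal
to sweep `(0, 1)`. -/
theorem exists_deriv_eq_of_growth {f : ℝ → ℝ} (hf : Differentiable ℝ f)
    (hc : Continuous (deriv f)) (hpos : ∀ t, 0 < f t) (hgt : ∀ t, t < f t)
    {c : ℝ} (hc0 : 0 < c) (hc1 : c < 1) : ∃ t, deriv f t = c := by
  have hlow : ∃ a, deriv f a ≤ c := by
    by_contra! h
    have hs : -(f 0 / c) ≤ 0 := by have := div_pos (hpos 0) hc0; linarith
    have := mul_sub_le_image_sub_of_le_deriv hf (fun x => (h x).le) hs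
    have h2 : c * (0 - -(f 0 / c)) = f 0 := by field_simp; ring
    linarith [hpos (-(f 0 / c))]
  have hhigh : ∃ b, c ≤ deriv f b := by
    by_contra! h
    have hs : 0 ≤ f 0 / (1 - c) := (div_pos (hpos 0) (by linarith)).le
    have := image_sub_le_mul_sub_of_deriv_le hf (fun x => (h x).le) hs
    have h2 : (1 - c) * (f 0 / (1 - c)) = f 0 := mul_div_cancel₀ _ (by linarith)
    linarith [hgt (f 0 / (1 - c))]
  obtain ⟨a, ha⟩ := hlow
  obtain ⟨b, hb⟩ := hhigh
  exact mem_range_of_exists_le_of_exists_ge hc ⟨a, ha⟩ ⟨b, hb⟩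

namespace IsAdmissibleProfile

variable {n k : ℕ} {f : ℝ → ℝ}

theorem pos (hf : IsAdmissibleProfile n k f) (hkn : k ≤ n) (t : ℝ) : 0 < f t := by
  have h : 0 ≤ lk n k := by
    have : (k : ℝ) ≤ n := by exact_mod_cast hkn
    exact rpow_nonneg (div_nonneg (by linarith) (Nat.cast_nonneg n)) _
  exact h.trans_lt ((le_max_left _ _).trans_lt (hf.2.2.2.2.1 t).1)

theorem one_sub_deriv_sq_pos (hf : IsAdmissibleProfile n k f) (t : ℝ) :
    0 < 1 - deriv f t ^ 2 := by
  obtain ⟨h0, h1, -⟩ := hf.2.2.1 t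
  nlinarith

theorem deriv_deriv_eq (hf : IsAdmissibleProfile n k f) (hk : 1 ≤ k) (hkn : k ≤ n) :
    deriv (deriv f) = fun t =>
      (n - ((n : ℝ) - k) / (f t ^ k * (1 - deriv f t ^ 2) ^ ((k : ℝ) / 2))) *
        (f t ^ (k - 1) * (1 - deriv f t ^ 2) ^ ((k : ℝ) / 2 + 1)) / k := by
  funext t
  have hk0 : (k : ℝ) ≠ 0 := by positivity
  have hne : f t ^ (k - 1) * (1 - deriv f t ^ 2) ^ ((k : ℝ) / 2 + 1) ≠ 0 :=
    (mul_pos (pow_pos (hf.pos hkn t) _) (rpow_pos_of_pos (hf.one_sub_deriv_sq_pos t) _)).ne'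
  rw [eq_div_iff hk0, ← eq_sub_of_add_eq (hf.2.1 t), div_mul_cancel₀ _ hne, mul_comm]

/-- A profile is smooth, by bootstrapping its equation. -/
theorem contDiff (hf : IsAdmissibleProfile n k f) (hk : 1 ≤ k) (hkn : k ≤ n) :
    ContDiff ℝ (⊤ : ℕ∞) f := by
  have key : ∀ m : ℕ, ContDiff ℝ ((m : WithTop ℕ∞) + 1) f ∧
      ContDiff ℝ ((m : WithTop ℕ∞) + 1) (deriv f) := by
    intro m
    induction m with
    | zero =>
      have h2 : ContDiff ℝ ((1 : WithTop ℕ∞) + 1) f := by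
        rw [one_add_one_eq_two]
        exact hf.1
      simp only [Nat.cast_zero, zero_add]
      exact ⟨hf.1.of_le one_le_two, (contDiff_succ_iff_deriv.1 h2).2.2⟩
    | succ m ih =>
      obtain ⟨h1, h2⟩ := ih
      have hdd : ContDiff ℝ ((m : WithTop ℕ∞) + 1) (deriv (deriv f)) := by
        rw [hf.deriv_deriv_eq hk hkn]
        have hw : ContDiff ℝ ((m : WithTop ℕ∞) + 1) (fun t => 1 - deriv f t ^ 2) :=
          contDiff_const.sub (h2.pow 2)
        have hr : ∀ p : ℝ, ContDiff ℝ ((m : WithTop ℕ∞) + 1)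
            (fun t => (1 - deriv f t ^ 2) ^ p) := fun p =>
          hw.rpow_const_of_ne fun t => (hf.one_sub_deriv_sq_pos t).ne'
        have hne : ∀ t, f t ^ k * (1 - deriv f t ^ 2) ^ ((k : ℝ) / 2) ≠ 0 := fun t =>
          (mul_pos (pow_pos (hf.pos hkn t) _)
            (rpow_pos_of_pos (hf.one_sub_deriv_sq_pos t) _)).ne'
        exact ((contDiff_const.sub (contDiff_const.div ((h1.pow k).mul (hr _)) hne)).mul
          ((h1.pow (k - 1)).mul (hr _))).div_const _
      push_cast
      have hω : ∀ g : ℝ → ℝ, (m : WithTop ℕ∞) + 1 = ⊤ → AnalyticOn ℝ g Set.univ := by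
        intro g h
        exact absurd h (by exact_mod_cast WithTop.coe_ne_top)
      exact ⟨contDiff_succ_iff_deriv.2 ⟨h1.differentiable (by simp), hω _, h2⟩,
        contDiff_succ_iff_deriv.2 ⟨h2.differentiable (by simp), hω _, hdd⟩⟩
  exact contDiff_infty.2 fun m => (key m).1.of_le le_self_add

end IsAdmissibleProfile

section zfun

variable {n : ℕ} [NeZero n] {f : ℝ → ℝ}

theorem zfun_arg_pos (hpos : ∀ t, 0 < f t) (x : EuclideanSpace ℝ (Fin n)) :
    0 < f (x 0) ^ 2 + ∑ i ∈ Finset.univ.erase (0 : Fin n), x i ^ 2 :=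
  add_pos_of_pos_of_nonneg (pow_pos (hpos _) 2) (Finset.sum_nonneg fun _ _ => sq_nonneg _)

theorem zfun_pos (hpos : ∀ t, 0 < f t) (x : EuclideanSpace ℝ (Fin n)) : 0 < zfun n f x :=
  Real.sqrt_pos.2 (zfun_arg_pos hpos x)

theorem zfun_sq (x : EuclideanSpace ℝ (Fin n)) :
    zfun n f x ^ 2 = f (x 0) ^ 2 + ∑ i ∈ Finset.univ.erase (0 : Fin n), x i ^ 2 :=
  Real.sq_sqrt (add_nonneg (sq_nonneg _) (Finset.sum_nonneg fun _ _ => sq_nonneg _))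

theorem contDiff_zfun (hpos : ∀ t, 0 < f t) {m : WithTop ℕ∞} (hf : ContDiff ℝ m f) :
    ContDiff ℝ m (zfun n f) := by
  have hx : ∀ i : Fin n, ContDiff ℝ m (fun x : EuclideanSpace ℝ (Fin n) => x i) := fun i =>
    (EuclideanSpace.proj (𝕜 := ℝ) i).contDiff
  exact ContDiff.sqrt (((hf.comp (hx 0)).pow 2).add (ContDiff.sum fun i _ => (hx i).pow 2))
    fun x => (zfun_arg_pos hpos x).ne'

theorem gradient_zfun (hpos : ∀ t, 0 < f t) (hf : Differentiable ℝ f)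
    (x : EuclideanSpace ℝ (Fin n)) :
    gradient (zfun n f) x = WithLp.toLp 2 (fun i =>
      if i = 0 then f (x 0) * deriv f (x 0) / zfun n f x else x i / zfun n f x) := by
  apply HasGradientAt.gradient
  rw [hasGradientAt_iff_hasFDerivAt]
  have hx : ∀ i : Fin n, HasFDerivAt (fun x : EuclideanSpace ℝ (Fin n) => x i)
      (EuclideanSpace.proj (𝕜 := ℝ) i) x := fun i =>
    (EuclideanSpace.proj (𝕜 := ℝ) i).hasFDerivAt
  have h : HasFDerivAt (zfun n f) ((1 / (2 * zfun n f x)) •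
      ((2 • f (x 0) ^ (2 - 1)) • deriv f (x 0) • EuclideanSpace.proj (𝕜 := ℝ) (0 : Fin n) +
        ∑ i ∈ Finset.univ.erase (0 : Fin n),
          (2 • x i ^ (2 - 1)) • EuclideanSpace.proj (𝕜 := ℝ) i)) x :=
    ((((hf (x 0)).hasDerivAt.comp_hasFDerivAt x (hx 0)).pow 2).add
    (HasFDerivAt.fun_sum fun i (_ : i ∈ Finset.univ.erase (0 : Fin n)) => (hx i).pow 2)).sqrt
      (zfun_arg_pos hpos x).ne'
  refine h.congr_fderiv ?_
  ext y
  change _ = inner ℝ _ y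
  have hz0 := (zfun_pos hpos x).ne'
  rw [PiLp.inner_apply, ← Finset.add_sum_erase _ _ (Finset.mem_univ (0 : Fin n)),
    Finset.sum_congr rfl (g := fun i => (1 / zfun n f x) * (x i * y i))]
  · simp [← Finset.mul_sum, mul_assoc, -Finset.sum_erase_eq_sub]
    field_simp
  · intro i hi
    simp [Finset.ne_of_mem_erase hi]
    ring

end zfun

/-- The semitrough `z(x) = √(f(x₁)² + |x̄|²)` is smooth and spacelike, and the image of
its gradient map is exactly the open half-disc `{ξ : |ξ| < 1, ξ₁ > 0}`. -/
theorem semitrough_spacelike_gaussMap_halfDisc (n k : ℕ) [NeZero n]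
    (hn : 2 ≤ n) (hk1 : 1 ≤ k) (hkn : k ≤ n)
    (f : ℝ → ℝ) (hf : IsAdmissibleProfile n k f) :
    ContDiff ℝ (⊤ : ℕ∞) (zfun n f) ∧
    (∀ x : EuclideanSpace ℝ (Fin n), ‖gradient (zfun n f) x‖ < 1) ∧
    Set.range (gradient (zfun n f)) =
      {ξ : EuclideanSpace ℝ (Fin n) | ‖ξ‖ < 1 ∧ 0 < ξ 0} := by
  have hpos := hf.pos hkn
  have hd : Differentiable ℝ f := hf.1.differentiable (by simp)
  have hgrad := gradient_zfun (n := n) hpos hd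
  have hnorm : ∀ ξ : EuclideanSpace ℝ (Fin n),
      ‖ξ‖ ^ 2 = ξ 0 ^ 2 + ∑ i ∈ Finset.univ.erase (0 : Fin n), ξ i ^ 2 := fun ξ => by
    rw [EuclideanSpace.real_norm_sq_eq,
      ← Finset.add_sum_erase _ (fun i => ξ i ^ 2) (Finset.mem_univ (0 : Fin n))]
  have hlt : ∀ x : EuclideanSpace ℝ (Fin n), ‖gradient (zfun n f) x‖ < 1 := by
    intro x
    have hz := zfun_pos hpos x
    rw [← sq_lt_one_iff₀ (norm_nonneg _), hnorm, hgrad,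
      Finset.sum_congr rfl (g := fun i => x i ^ 2 / zfun n f x ^ 2)
        fun i hi => by simp [Finset.ne_of_mem_erase hi, div_pow],
      ← Finset.sum_div]
    simp only [if_true, div_pow]
    rw [← add_div, div_lt_one (pow_pos hz 2), zfun_sq, mul_pow]
    have := mul_pos (pow_pos (hpos (x 0)) 2) (hf.one_sub_deriv_sq_pos (x 0))
    linarith
  refine ⟨contDiff_zfun hpos (hf.contDiff hk1 hkn), hlt, Set.Subset.antisymm ?_ ?_⟩
  · rintro _ ⟨x, rfl⟩
    refine ⟨hlt x, ?_⟩
    rw [hgrad]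
    simpa using div_pos (mul_pos (hpos _) (hf.2.2.1 _).1) (zfun_pos hpos x)
  · rintro ξ ⟨hξ, hξ0⟩
    set S := ∑ i ∈ Finset.univ.erase (0 : Fin n), ξ i ^ 2 with hS
    have hlt1 : ξ 0 ^ 2 + S < 1 := by
      rw [← hnorm]
      exact (sq_lt_one_iff₀ (norm_nonneg _)).2 hξ
    have hS1 : 0 < 1 - S := by nlinarith
    have hr := Real.sqrt_pos.2 hS1
    have hr2 := Real.sq_sqrt hS1.le
    set r := √(1 - S)
    obtain ⟨t, ht⟩ := exists_deriv_eq_of_growth hd (hf.1.continuous_deriv (by simp)) hpos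
      (fun t => (le_max_right _ _).trans_lt (hf.2.2.2.2.1 t).1) (div_pos hξ0 hr)
      ((div_lt_one hr).2 (lt_of_pow_lt_pow_left₀ 2 hr.le (by linarith)))
    have hft := hpos t
    let x : EuclideanSpace ℝ (Fin n) :=
      WithLp.toLp 2 (fun i => if i = 0 then t else f t / r * ξ i)
    have hx0 : x 0 = t := by simp [x]
    have hxi : ∀ i : Fin n, i ≠ 0 → x i = f t / r * ξ i := fun i hi => by simp [x, hi]
    have hz : zfun n f x = f t / r := by
      rw [← sq_eq_sq₀ (zfun_pos hpos x).le (div_pos hft hr).le, zfun_sq, hx0,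
        Finset.sum_congr rfl (g := fun i => (f t / r) ^ 2 * ξ i ^ 2)
          fun i hi => by rw [hxi i (Finset.ne_of_mem_erase hi), mul_pow],
        ← Finset.mul_sum, ← hS]
      field_simp
      linarith
    refine ⟨x, ?_⟩
    rw [hgrad, hz, hx0, ht]
    ext i
    by_cases hi : i = 0
    · subst hi
      simp
      field_simp
    · simp only [hi, if_false, hxi i hi]
      field_simp
end

section
/- Let n ≥ 2, let q : ℝⁿ \ {0} → ℝ be homogeneous of degree zero (q(x) = q(x/|x|)), twice continuously differentiable with locally Lipschitz second derivatives, and satisfy q(y) = 0 for every y with y₁ ≤ 0, and let l > 0. Then there exists M₀ > 0 (depending on q, n and l) such that for every M ≥ M₀, every y ∈ 𝕊^{n-1}, and every x_n ≥ 0, writing p = Dq(y) + M·y ∈ ℝⁿ with components p = (p₁, …, pₙ), one has q(y) + √( l² + Σ_{i=2}^{n-1} p_i² + (x_n + p_n)² ) ≤ √( l² + (x_n + M)² ). -/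
open Filter Real
open scoped RealInnerProductSpace

/-- A map continuous at a point of the closed half-space `x i ≤ 0` and vanishing on the open
half-space `x i < 0` vanishes at that point. -/
theorem ContinuousAt.eq_zero_of_forall_coord_neg {ι F : Type*} [Fintype ι] [DecidableEq ι]
    [NormedAddCommGroup F] {f : EuclideanSpace ℝ ι → F} {i : ι} {z : EuclideanSpace ℝ ι}
    (hf : ContinuousAt f z) (hz : z i ≤ 0) (h0 : ∀ x : EuclideanSpace ℝ ι, x i < 0 → f x = 0) :
    f z = 0 := by
  have hline : Tendsto (fun s : ℝ => z - s • EuclideanSpace.single i (1 : ℝ))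
      (nhdsWithin 0 (Set.Ioi 0)) (nhds z) := by
    have hc : Continuous (fun s : ℝ => z - s • EuclideanSpace.single i (1 : ℝ)) := by fun_prop
    simpa using (hc.tendsto 0).mono_left nhdsWithin_le_nhds
  refine tendsto_nhds_unique (hf.tendsto.comp hline) (tendsto_const_nhds.congr' ?_)
  filter_upwards [self_mem_nhdsWithin] with s hs
  have hs' : (0 : ℝ) < s := hs
  refine (h0 _ ?_).symm
  simp
  linarith

/-- The derivative of a map vanishing on an open half-space vanishes there. -/
theorem fderiv_eq_zero_of_forall_coord_neg {ι F : Type*} [Fintype ι]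
    [NormedAddCommGroup F] [NormedSpace ℝ F] {f : EuclideanSpace ℝ ι → F} {i : ι}
    (h0 : ∀ x : EuclideanSpace ℝ ι, x i < 0 → f x = 0) (x : EuclideanSpace ℝ ι) (hx : x i < 0) :
    fderiv ℝ f x = 0 := by
  have hopen : IsOpen {x : EuclideanSpace ℝ ι | x i < 0} :=
    isOpen_lt (by fun_prop) continuous_const
  have : f =ᶠ[nhds x] fun _ => 0 := by
    filter_upwards [hopen.mem_nhds hx] with w hw using h0 w hw
  rw [this.fderiv_eq]
  simp

/-- Euler's identity for functions homogeneous of degree zero. -/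
theorem fderiv_apply_self_eq_zero_of_homogeneous {E : Type*} [NormedAddCommGroup E]
    [NormedSpace ℝ E] {q : E → ℝ} (hqhom : ∀ x : E, x ≠ 0 → q x = q (‖x‖⁻¹ • x)) {y : E}
    (hy : y ≠ 0) (hd : DifferentiableAt ℝ q y) : fderiv ℝ q y y = 0 := by
  have hray : HasDerivAt (fun s : ℝ => s • y) y 1 := by
    simpa using (hasDerivAt_id (1 : ℝ)).smul_const y
  have hcomp : HasDerivAt (fun s : ℝ => q (s • y)) (fderiv ℝ q y y) 1 := by
    have hd' : HasFDerivAt q (fderiv ℝ q y) ((1 : ℝ) • y) := by simpa using hd.hasFDerivAt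
    exact hd'.comp_hasDerivAt 1 hray
  refine hcomp.unique ((hasDerivAt_const (1 : ℝ) (q y)).congr_of_eventuallyEq ?_)
  filter_upwards [lt_mem_nhds (zero_lt_one : (0 : ℝ) < 1)] with s hs
  rw [hqhom _ (smul_ne_zero hs.ne' hy), hqhom y hy, norm_smul, smul_smul, Real.norm_of_nonneg hs.le]
  congr 2
  field_simp

/-- If `q` vanishes on a half-space `x i ≤ 0` and has a Lipschitz second derivative near a boundary
point `y₀`, then `q` and its derivative are `O((x i) ^ 2)` near `y₀`. -/
theorem exists_local_quadratic_bound {ι : Type*} [Fintype ι] [DecidableEq ι] (i : ι)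
    {q : EuclideanSpace ℝ ι → ℝ}
    (hq2 : ∀ x : EuclideanSpace ℝ ι, x ≠ 0 → ContDiffAt ℝ 2 q x)
    (hqzero : ∀ x : EuclideanSpace ℝ ι, x ≠ 0 → x i ≤ 0 → q x = 0)
    {y₀ : EuclideanSpace ℝ ι} (hy₀ : ‖y₀‖ = 1) (hi : y₀ i = 0) {ε : ℝ} (hε : 0 < ε) {K : NNReal}
    (hK : LipschitzOnWith K (fderiv ℝ (fderiv ℝ q)) (Metric.ball y₀ ε)) :
    ∀ᶠ y in nhds y₀, ‖fderiv ℝ q y‖ ≤ K * y i ^ 2 ∧ |q y| ≤ K * y i ^ 2 := by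
  set e : EuclideanSpace ℝ ι := EuclideanSpace.single i 1 with he
  set r : ℝ := min ε 1 with hr
  have hr0 : 0 < r := by positivity
  have hne : ∀ z ∈ Metric.ball y₀ r, z ≠ 0 := by
    rintro z hz rfl
    rw [Metric.mem_ball, dist_zero_left, hy₀] at hz
    linarith [min_le_right ε 1]
  have hneg : ∀ x : EuclideanSpace ℝ ι, x i < 0 → q x = 0 := fun x hx =>
    hqzero x (by rintro rfl; simp at hx) hx.le
  have hd1 : ∀ z : EuclideanSpace ℝ ι, z ≠ 0 → ContDiffAt ℝ 1 (fderiv ℝ q) z := fun z hz =>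
    (hq2 z hz).fderiv_right (by norm_num)
  have hD1 : ∀ z : EuclideanSpace ℝ ι, z ≠ 0 → z i ≤ 0 → fderiv ℝ q z = 0 := fun z hz hzi =>
    (hd1 z hz).continuousAt.eq_zero_of_forall_coord_neg hzi
      (fderiv_eq_zero_of_forall_coord_neg hneg)
  have hD2 : ∀ z : EuclideanSpace ℝ ι, z ≠ 0 → z i ≤ 0 → fderiv ℝ (fderiv ℝ q) z = 0 :=
    fun z hz hzi =>
    ((hd1 z hz).fderiv_right (m := 0) (by norm_num)).continuousAt.eq_zero_of_forall_coord_neg hzi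
      (fderiv_eq_zero_of_forall_coord_neg (fderiv_eq_zero_of_forall_coord_neg hneg))
  have hproj : ∀ y ∈ Metric.ball y₀ (r / 2), y - y i • e ∈ Metric.ball y₀ r ∧
      (y - y i • e) i = 0 ∧ ‖y - (y - y i • e)‖ = |y i| ∧ |y i| ≤ r / 2 := by
    intro y hy
    rw [mem_ball_iff_norm] at hy ⊢
    have h1 : |y i| ≤ ‖y - y₀‖ := by
      simpa [hi] using PiLp.norm_apply_le (y - y₀) i
    refine ⟨?_, by simp [he], by simp [he, norm_smul], by linarith⟩
    calc ‖y - y i • e - y₀‖ = ‖(y - y₀) - y i • e‖ := by congr 1; abel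
      _ ≤ ‖y - y₀‖ + ‖y i • e‖ := norm_sub_le _ _
      _ = ‖y - y₀‖ + |y i| := by simp [he, norm_smul]
      _ < r := by linarith
  have hseg : ∀ y ∈ Metric.ball y₀ (r / 2), segment ℝ (y - y i • e) y ⊆ Metric.ball y₀ r :=
    fun y hy => (convex_ball y₀ r).segment_subset (hproj y hy).1
      (Metric.ball_subset_ball (by linarith) hy)
  have hcoord : ∀ y : EuclideanSpace ℝ ι, ∀ z ∈ segment ℝ (y - y i • e) y,
      ‖z - (y - y i • e)‖ ≤ ‖y - (y - y i • e)‖ := fun y z hz => norm_sub_le_of_mem_segment hz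
  have hgrad : ∀ y ∈ Metric.ball y₀ r, y - y i • e ∈ Metric.ball y₀ r →
      ‖fderiv ℝ q y‖ ≤ K * y i ^ 2 := by
    intro y hy hp
    have hpi : (y - y i • e) i = 0 := by simp [he]
    have hs := (convex_ball y₀ r).segment_subset hp hy
    have hnorm : ‖y - (y - y i • e)‖ = |y i| := by simp [he, norm_smul]
    have key := (convex_segment (y - y i • e) y).norm_image_sub_le_of_norm_fderiv_le
      (𝕜 := ℝ) (f := fderiv ℝ q) (C := K * |y i|)
      (fun z hz => (hd1 z (hne z (hs hz))).differentiableAt (by norm_num))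
      (fun z hz => by
        have hsub := Metric.ball_subset_ball (x := y₀) (min_le_left ε 1)
        have := hK.norm_sub_le (hsub (hs hz)) (hsub hp)
        rw [hD2 _ (hne _ hp) hpi.le, sub_zero] at this
        refine this.trans (mul_le_mul_of_nonneg_left ?_ K.2)
        exact (hcoord y z hz).trans hnorm.le)
      (left_mem_segment ℝ _ _) (right_mem_segment ℝ _ _)
    rw [hD1 _ (hne _ hp) hpi.le, sub_zero, hnorm] at key
    calc ‖fderiv ℝ q y‖ ≤ K * |y i| * |y i| := key
      _ = K * y i ^ 2 := by rw [mul_assoc, abs_mul_abs_self, sq]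
  filter_upwards [Metric.ball_mem_nhds y₀ (half_pos hr0)] with y hy
  obtain ⟨hp, hpi, hnorm, hyr⟩ := hproj y hy
  refine ⟨hgrad y (Metric.ball_subset_ball (by linarith) hy) hp, ?_⟩
  have key := (convex_segment (y - y i • e) y).norm_image_sub_le_of_norm_fderiv_le
    (𝕜 := ℝ) (f := q) (C := K * y i ^ 2)
    (fun z hz => (hq2 z (hne z (hseg y hy hz))).differentiableAt (by norm_num))
    (fun z hz => by
      have hzp : z - z i • e = y - y i • e := by
        obtain ⟨a, b, ha, hb, hab, rfl⟩ := hz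
        ext j
        by_cases hj : j = i
        · subst hj; simp [he]
        · simp [he, hj]
          rw [← add_mul, hab, one_mul]
      refine (hgrad z (hseg y hy hz) (hzp ▸ hp)).trans (mul_le_mul_of_nonneg_left ?_ K.2)
      refine sq_le_sq.2 ?_
      have h1 := hcoord y z hz
      rw [hnorm, ← hzp] at h1
      simpa [he, norm_smul] using h1)
    (left_mem_segment ℝ _ _) (right_mem_segment ℝ _ _)
  rw [hqzero _ (hne _ hp) hpi.le, sub_zero, hnorm, Real.norm_eq_abs] at key
  refine key.trans (mul_le_of_le_one_right (by positivity) ?_)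
  linarith [min_le_right ε 1]

/-- A `C^{2,1}` function vanishing on a half-space `x i ≤ 0` is, together with its derivative,
bounded on the unit sphere by a multiple of `(x i) ^ 2`. -/
theorem exists_sphere_quadratic_bound {ι : Type*} [Fintype ι] [DecidableEq ι] (i : ι)
    {q : EuclideanSpace ℝ ι → ℝ}
    (hq2 : ∀ x : EuclideanSpace ℝ ι, x ≠ 0 → ContDiffAt ℝ 2 q x)
    (hq21 : ∀ x : EuclideanSpace ℝ ι, x ≠ 0 → ∃ ε > (0 : ℝ), ∃ K : NNReal,
      LipschitzOnWith K (fderiv ℝ (fderiv ℝ q)) (Metric.ball x ε))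
    (hqzero : ∀ x : EuclideanSpace ℝ ι, x ≠ 0 → x i ≤ 0 → q x = 0) :
    ∃ C ≥ (0 : ℝ), ∀ y : EuclideanSpace ℝ ι, ‖y‖ = 1 →
      ‖fderiv ℝ q y‖ ≤ C * y i ^ 2 ∧ |q y| ≤ C * y i ^ 2 := by
  suffices h : ∃ C ≥ (0 : ℝ), ∀ y ∈ Metric.sphere (0 : EuclideanSpace ℝ ι) 1,
      ‖fderiv ℝ q y‖ ≤ C * y i ^ 2 ∧ |q y| ≤ C * y i ^ 2 by simpa using h
  refine (isCompact_sphere (0 : EuclideanSpace ℝ ι) 1).induction_on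
    (p := fun s => ∃ C ≥ (0 : ℝ), ∀ y ∈ s, ‖fderiv ℝ q y‖ ≤ C * y i ^ 2 ∧ |q y| ≤ C * y i ^ 2)
    ⟨0, le_rfl, by simp⟩ ?_ ?_ ?_
  · rintro s t hst ⟨C, hC, h⟩
    exact ⟨C, hC, fun y hy => h y (hst hy)⟩
  · rintro s t ⟨C, hC, h⟩ ⟨C', hC', h'⟩
    refine ⟨C + C', by positivity, ?_⟩
    rintro y (hy | hy)
    · have := h y hy
      constructor <;> nlinarith [sq_nonneg (y i)]
    · have := h' y hy
      constructor <;> nlinarith [sq_nonneg (y i)]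
  · intro y₀ hy₀
    have hy₁ : ‖y₀‖ = 1 := by simpa using hy₀
    have hne : y₀ ≠ 0 := by rintro rfl; simp at hy₁
    suffices h : ∃ C ≥ (0 : ℝ), ∀ᶠ y in nhds y₀,
        ‖fderiv ℝ q y‖ ≤ C * y i ^ 2 ∧ |q y| ≤ C * y i ^ 2 by
      obtain ⟨C, hC, h⟩ := h
      exact ⟨_, mem_nhdsWithin_of_mem_nhds h, C, hC, fun y hy => hy⟩
    by_cases hi : y₀ i = 0
    · obtain ⟨ε, hε, K, hK⟩ := hq21 y₀ hne
      exact ⟨K, K.2, exists_local_quadratic_bound i hq2 hqzero hy₁ hi hε hK⟩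
    · have hsq : 0 < y₀ i ^ 2 := by positivity
      have hcq := (hq2 y₀ hne).continuousAt.abs
      have hcd := ((hq2 y₀ hne).fderiv_right (m := 1) (by norm_num)).continuousAt.norm
      set C : ℝ := (‖fderiv ℝ q y₀‖ + |q y₀| + 1) / y₀ i ^ 2 with hC
      have hCy : C * y₀ i ^ 2 = ‖fderiv ℝ q y₀‖ + |q y₀| + 1 := by
        rw [hC]; field_simp
      have hcr : ContinuousAt (fun y : EuclideanSpace ℝ ι => C * y i ^ 2) y₀ := by fun_prop
      have hn := norm_nonneg (fderiv ℝ q y₀)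
      have ha := abs_nonneg (q y₀)
      refine ⟨C, by positivity, ?_⟩
      filter_upwards [hcd.eventually_lt hcr (by simp only [hCy]; linarith),
        hcq.eventually_lt hcr (by simp only [hCy]; linarith)] with y h1 h2
      exact ⟨h1.le, h2.le⟩

/-- The scalar inequality behind `subsolution_tricky_direction`: here `t`, `s` are two coordinates
of a unit vector, `a`, `b` the matching coordinates of a vector of norm `g`, and `v` the value
of the function. -/
theorem add_sqrt_le_sqrt_of_quadratic_bounds {C M l t s a b g v x : ℝ} (hC : 0 ≤ C) (hl : 0 < l)
    (hM : 8 * C + l ≤ M) (hx : 0 ≤ x) (hts : t ^ 2 + s ^ 2 ≤ 1) (hg : g ≤ C * t ^ 2)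
    (ha : |a| ≤ g) (hb : |b| ≤ g) (hv : v ≤ C * t ^ 2) :
    v + √(l ^ 2 + (g ^ 2 + M ^ 2 - (a + M * t) ^ 2) + x ^ 2 + 2 * x * (b + M * s)) ≤
      √(l ^ 2 + (x + M) ^ 2) := by
  have ht1 : t ^ 2 ≤ 1 := by nlinarith [sq_nonneg s]
  have ht : |t| ≤ 1 := (sq_le_one_iff_abs_le_one t).1 ht1
  have hM0 : 0 < M := by linarith
  have hg0 : 0 ≤ g := (abs_nonneg a).trans ha
  have hs : t ^ 2 / 2 ≤ 1 - s := by nlinarith [sq_nonneg (1 - s)]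
  have hCt : C * t ^ 2 ≤ C := mul_le_of_le_one_right hC ht1
  set R := √(l ^ 2 + (x + M) ^ 2) with hR
  have hR2 : R ^ 2 = l ^ 2 + (x + M) ^ 2 := Real.sq_sqrt (by positivity)
  have hRM : M ≤ R := Real.le_sqrt_of_sq_le (by nlinarith)
  have hRle : R ≤ 2 * (x + M) := Real.sqrt_le_iff.2 ⟨by positivity, by nlinarith⟩
  have hat : -(C * t ^ 2) ≤ a * t := by
    have : |a * t| ≤ C * t ^ 2 := by
      rw [abs_mul]
      calc |a| * |t| ≤ |a| * 1 := by gcongr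
        _ ≤ C * t ^ 2 := by linarith
    exact (abs_le.1 this).1
  have hg2 : g ^ 2 ≤ C ^ 2 * t ^ 2 := by
    calc g ^ 2 ≤ (C * t ^ 2) ^ 2 := by gcongr
      _ = C ^ 2 * t ^ 2 * t ^ 2 := by ring
      _ ≤ C ^ 2 * t ^ 2 := mul_le_of_le_one_right (by positivity) ht1
  have hp : M ^ 2 / 2 * t ^ 2 ≤ (a + M * t) ^ 2 - g ^ 2 := by
    have h1 : C ^ 2 + 2 * M * C ≤ M ^ 2 / 2 := by nlinarith
    have h2 := mul_le_mul_of_nonneg_right h1 (sq_nonneg t)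
    have h3 := mul_le_mul_of_nonneg_left hat hM0.le
    nlinarith [sq_nonneg a]
  have hpn : M / 4 * t ^ 2 ≤ M - (b + M * s) := by
    have h1 := mul_le_mul_of_nonneg_left hs hM0.le
    have h2 : C * t ^ 2 ≤ M / 4 * t ^ 2 := by gcongr; linarith
    linarith [le_abs_self b]
  have hxp := mul_le_mul_of_nonneg_left hpn hx
  have hCR : 2 * (C * t ^ 2) * R ≤ M / 2 * t ^ 2 * (x + M) := by
    calc 2 * (C * t ^ 2) * R ≤ 2 * (C * t ^ 2) * (2 * (x + M)) := by gcongr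
      _ = 4 * C * (t ^ 2 * (x + M)) := by ring
      _ ≤ M / 2 * (t ^ 2 * (x + M)) := by gcongr; linarith
      _ = M / 2 * t ^ 2 * (x + M) := by ring
  have : √(l ^ 2 + (g ^ 2 + M ^ 2 - (a + M * t) ^ 2) + x ^ 2 + 2 * x * (b + M * s)) ≤
      R - C * t ^ 2 := by
    refine Real.sqrt_le_iff.2 ⟨by linarith, ?_⟩
    nlinarith [sq_nonneg (C * t ^ 2)]
  linarith

/-- Core inequality for the asymptotic control of the subsolution in the directions
where `x₁ → -∞` with `xₙ ≥ 0` bounded: for `M` large, every unit `y` and every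
`xₙ ≥ 0`, writing `p = Dq(y) + M y`,
`q(y) + √(l² + Σ_{i=2}^{n-1} pᵢ² + (xₙ + pₙ)²) ≤ √(l² + (xₙ + M)²)`. -/
theorem subsolution_tricky_direction (n : ℕ) [NeZero n] (hn : 2 ≤ n)
    (q : EuclideanSpace ℝ (Fin n) → ℝ)
    (hq2 : ContDiffOn ℝ 2 q {x : EuclideanSpace ℝ (Fin n) | x ≠ 0})
    (hq21 : ∀ x : EuclideanSpace ℝ (Fin n), x ≠ 0 →
      ∃ ε > (0 : ℝ), ∃ K : NNReal,
        LipschitzOnWith K (fderiv ℝ (fderiv ℝ q)) (Metric.ball x ε))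
    (hqhom : ∀ x : EuclideanSpace ℝ (Fin n), x ≠ 0 → q x = q (‖x‖⁻¹ • x))
    (hqzero : ∀ x : EuclideanSpace ℝ (Fin n), x ≠ 0 → x 0 ≤ 0 → q x = 0)
    (l : ℝ) (hl : 0 < l) :
    ∃ M₀ > (0 : ℝ), ∀ M ≥ M₀, ∀ y : EuclideanSpace ℝ (Fin n), ‖y‖ = 1 →
      ∀ xn : ℝ, 0 ≤ xn →
        q y + Real.sqrt (l ^ 2 +
            (∑ i ∈ (Finset.univ.erase (0 : Fin n)).erase ⟨n - 1, by omega⟩,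
              ((gradient q y + M • y) i) ^ 2) +
            (xn + (gradient q y + M • y) ⟨n - 1, by omega⟩) ^ 2) ≤
          Real.sqrt (l ^ 2 + (xn + M) ^ 2) := by
  have hq2' : ∀ x : EuclideanSpace ℝ (Fin n), x ≠ 0 → ContDiffAt ℝ 2 q x := fun x hx =>
    hq2.contDiffAt (isOpen_ne.mem_nhds hx)
  obtain ⟨C, hC, hbound⟩ := exists_sphere_quadratic_bound 0 hq2' hq21 hqzero
  refine ⟨8 * C + l, by positivity, fun M hM y hy x hx => ?_⟩
  have hy0 : y ≠ 0 := by rintro rfl; simp at hy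
  obtain ⟨hgrad, hval⟩ := hbound y hy
  have hgnorm : ‖gradient q y‖ = ‖fderiv ℝ q y‖ := by simp [gradient]
  have hinner : ⟪gradient q y, y⟫ = 0 := by
    rw [gradient, InnerProductSpace.toDual_symm_apply]
    exact fderiv_apply_self_eq_zero_of_homogeneous hqhom hy0
      ((hq2' y hy0).differentiableAt (by norm_num))
  set j : Fin n := ⟨n - 1, by omega⟩ with hj
  have hj0 : j ≠ 0 := by
    intro h
    have := congrArg Fin.val h
    simp [hj] at this
    omega
  have hmem : j ∈ Finset.univ.erase (0 : Fin n) := by simp [hj0]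
  have hsplit : ∀ w : EuclideanSpace ℝ (Fin n),
      w 0 ^ 2 + (w j ^ 2 + ∑ i ∈ (Finset.univ.erase (0 : Fin n)).erase j, w i ^ 2) = ‖w‖ ^ 2 := by
    intro w
    rw [Finset.add_sum_erase _ (fun i => w i ^ 2) hmem,
      Finset.add_sum_erase _ (fun i => w i ^ 2) (Finset.mem_univ 0), EuclideanSpace.real_norm_sq_eq]
  have hpnorm : ‖gradient q y + M • y‖ ^ 2 = ‖gradient q y‖ ^ 2 + M ^ 2 := by
    rw [norm_add_sq_real, real_inner_smul_right, hinner, norm_smul, hy]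
    simp
  have hts : y 0 ^ 2 + y j ^ 2 ≤ 1 := by
    have h1 := hsplit y
    have h2 : 0 ≤ ∑ i ∈ (Finset.univ.erase (0 : Fin n)).erase j, y i ^ 2 :=
      Finset.sum_nonneg fun i _ => sq_nonneg _
    rw [hy] at h1
    linarith
  have hscalar := add_sqrt_le_sqrt_of_quadratic_bounds hC hl hM hx hts (hgnorm.le.trans hgrad)
    (PiLp.norm_apply_le (gradient q y) 0) (PiLp.norm_apply_le (gradient q y) j)
    ((le_abs_self _).trans hval)
  convert hscalar using 3
  have h := hsplit (gradient q y + M • y)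
  rw [hpnorm] at h
  simp only [PiLp.add_apply, PiLp.smul_apply, smul_eq_mul] at h ⊢
  linear_combination h
end

section
/- Let n ≥ 2 and let u : ℝⁿ → ℝ be a smooth spacelike function (|Du(x)| < 1 for all x) whose graph has constant mean curvature n, i.e. div( Du/√(1 - |Du|²) ) = n on ℝⁿ. Suppose further: (2) for every ε > 0 there exists R > 0 such that |u(x) - V₊(x)| < ε whenever |x| ≥ R and x₁ ≥ 0, and also whenever x₁ ≤ -R and |x̄| ≥ R; and (3) there is a constant C₀ with |u(x) - V₊(x)| ≤ C₀ for all x ∈ ℝⁿ. Then u is the standard semitrough of constant mean curvature: there exists a twice continuously differentiable function f : ℝ → ℝ with 0 < f'(t) < 1 and f''(t) > 0 for all t, lim_{t→-∞} f(t) = (n-1)/n, max{(n-1)/n, t} < f(t) < √(1+t²), satisfying f''(t)/(1 - f'(t)²)^{3/2} + (n-1)/( f(t)·(1 - f'(t)²)^{1/2} ) = n for all t, such that u(x) = √( f(x₁)² + |x̄|² ) for all x ∈ ℝⁿ. -/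
open Filter Real

/-- `V₊(x) = sup { x·λ : λ ∈ 𝕊^{n-1}, λ₁ ≥ 0 }`; explicitly `|x|` if `x₁ ≥ 0`
and `|x̄|` if `x₁ < 0`. -/
noncomputable def Vplus (n : ℕ) [NeZero n] (x : EuclideanSpace ℝ (Fin n)) : ℝ :=
  if 0 ≤ x 0 then ‖x‖ else Real.sqrt (∑ i ∈ Finset.univ.erase (0 : Fin n), x i ^ 2)

/-- The divergence of a vector field `W` on `ℝⁿ`: `div W x = Σᵢ ∂ᵢ Wᵢ (x)`. -/
noncomputable def divg (n : ℕ) (W : EuclideanSpace ℝ (Fin n) → EuclideanSpace ℝ (Fin n))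
    (x : EuclideanSpace ℝ (Fin n)) : ℝ :=
  ∑ i : Fin n, fderiv ℝ (fun z => W z i) x (EuclideanSpace.single i 1)

section Setup

variable {n : ℕ} [NeZero n]

/-- `|x̄|²`, the squared length of all coordinates but the first. -/
noncomputable def radSq (x : EuclideanSpace ℝ (Fin n)) : ℝ :=
  ∑ i ∈ Finset.univ.erase (0 : Fin n), x i ^ 2

lemma radSq_nonneg (x : EuclideanSpace ℝ (Fin n)) : 0 ≤ radSq x :=
  Finset.sum_nonneg fun _ _ => sq_nonneg _

lemma norm_sq_eq_add_radSq (x : EuclideanSpace ℝ (Fin n)) : ‖x‖ ^ 2 = x 0 ^ 2 + radSq x := by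
  rw [EuclideanSpace.real_norm_sq_eq, radSq, Finset.add_sum_erase _ (fun i => x i ^ 2)
    (Finset.mem_univ 0)]

lemma continuous_radSq : Continuous (radSq : EuclideanSpace ℝ (Fin n) → ℝ) := by
  unfold radSq; fun_prop

lemma inner_gradient_eq_fderiv {n : ℕ} {u : EuclideanSpace ℝ (Fin n) → ℝ}
    (x e : EuclideanSpace ℝ (Fin n)) :
    inner ℝ (gradient u x) e = fderiv ℝ u x e := by
  simp [gradient]

lemma differentiable_gradient {n : ℕ} {u : EuclideanSpace ℝ (Fin n) → ℝ}
    (hsm : ContDiff ℝ (⊤ : ℕ∞) u) :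
    Differentiable ℝ (gradient u) := by
  have h : ContDiff ℝ 1 (fderiv ℝ u) := hsm.fderiv_right (by norm_cast)
  exact (InnerProductSpace.toDual ℝ _).symm.toContinuousLinearEquiv.differentiable.comp
    (h.differentiable (by norm_num))

/-- The mean curvature operator in terms of the derivative of the gradient. -/
lemma divg_gradient_eq {n : ℕ} {u : EuclideanSpace ℝ (Fin n) → ℝ} (hsm : ContDiff ℝ (⊤ : ℕ∞) u)
    (hsp : ∀ x, ‖gradient u x‖ < 1) (x : EuclideanSpace ℝ (Fin n)) :
    divg n (fun z => (Real.sqrt (1 - ‖gradient u z‖ ^ 2))⁻¹ • gradient u z) x =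
      (Real.sqrt (1 - ‖gradient u x‖ ^ 2))⁻¹ *
        (∑ i, inner ℝ (fderiv ℝ (gradient u) x (EuclideanSpace.single i 1))
          (EuclideanSpace.single i 1)) +
      (Real.sqrt (1 - ‖gradient u x‖ ^ 2))⁻¹ ^ 3 *
        inner ℝ (fderiv ℝ (gradient u) x (gradient u x)) (gradient u x) := by
  have hG := (differentiable_gradient hsm x).hasFDerivAt
  set G := gradient u with hGdef
  set L := fderiv ℝ G x with hL
  have hpos : 0 < 1 - ‖G x‖ ^ 2 := by nlinarith [hsp x, norm_nonneg (G x)]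
  have key : ∀ i : Fin n, fderiv ℝ (fun z => ((Real.sqrt (1 - ‖G z‖ ^ 2))⁻¹ • G z) i) x
      (EuclideanSpace.single i 1) = (Real.sqrt (1 - ‖G x‖ ^ 2))⁻¹ *
        inner ℝ (L (EuclideanSpace.single i 1)) (EuclideanSpace.single i 1) +
        (Real.sqrt (1 - ‖G x‖ ^ 2))⁻¹ ^ 3 *
        (inner ℝ (L (G x i • EuclideanSpace.single i 1)) (G x)) := by
    intro i
    have h1 := (hasDerivAt_inv (Real.sqrt_pos.mpr hpos).ne').comp_hasFDerivAt x
      ((hG.norm_sq.const_sub 1).sqrt hpos.ne')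
    have h2 : HasFDerivAt (fun z => G z i)
        ((EuclideanSpace.proj i : EuclideanSpace ℝ (Fin n) →L[ℝ] ℝ).comp L) x :=
      (EuclideanSpace.proj i : EuclideanSpace ℝ (Fin n) →L[ℝ] ℝ).hasFDerivAt.comp x hG
    have h3 := h1.mul h2
    have h4 : (fun z => ((Real.sqrt (1 - ‖G z‖ ^ 2))⁻¹ • G z) i) =
      (fun z => (Real.sqrt (1 - ‖G z‖ ^ 2))⁻¹ * G z i) := by ext z; simp
    rw [h4]
    refine (congrArg (fun l => l (EuclideanSpace.single i (1:ℝ))) h3.fderiv).trans ?_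
    have hs := (Real.sqrt_pos.mpr hpos).ne'
    simp [real_inner_smul_right, EuclideanSpace.inner_single_right, real_inner_comm]
    field_simp
  unfold divg
  simp only [key]
  rw [Finset.sum_add_distrib, ← Finset.mul_sum, ← Finset.mul_sum, ← sum_inner, ← map_sum]
  congr 4
  simpa using (EuclideanSpace.basisFun (Fin n) ℝ).sum_repr (G x)

end Setup

/-- If `φ` has a local maximum at `0`, then its first derivative vanishes there and its second
derivative is nonpositive. -/
lemma IsLocalMax.second_deriv_nonpos {φ φ' : ℝ → ℝ} {b : ℝ} (hmax : IsLocalMax φ 0)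
    (h1 : ∀ᶠ s in nhds 0, HasDerivAt φ (φ' s) s) (h2 : HasDerivAt φ' b 0) :
    φ' 0 = 0 ∧ b ≤ 0 := by
  have h0 : φ' 0 = 0 := hmax.hasDerivAt_eq_zero h1.self_of_nhds
  refine ⟨h0, ?_⟩
  by_contra! hb
  have hd : deriv φ =ᶠ[nhds 0] φ' := h1.mono fun s hs => hs.deriv
  have hmin : IsLocalMin φ 0 := by
    apply isLocalMin_of_deriv_deriv_pos
    · rw [hd.deriv_eq, h2.deriv]; exact hb
    · rw [hd.self_of_nhds, h0]
    · exact h1.self_of_nhds.continuousAt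
  have hc : φ =ᶠ[nhds 0] fun _ => φ 0 := by
    filter_upwards [hmax, hmin] with s h h' using le_antisymm h h'
  have hz : φ' =ᶠ[nhds 0] fun _ => 0 := by
    filter_upwards [h1, hc.eventuallyEq_nhds] with s hs hcs
    rw [← hs.deriv, hcs.deriv_eq]; simp
  have := h2.deriv
  rw [hz.deriv_eq] at this
  simp at this
  linarith

section Touching

variable {n : ℕ} [NeZero n]

/-- The rotationally and boost invariant function `√(g(x₁)² + |x̄|²)` with profile `g`. -/
noncomputable def invGraph (g : ℝ → ℝ) (x : EuclideanSpace ℝ (Fin n)) : ℝ :=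
  Real.sqrt (g (x 0) ^ 2 + radSq x)

lemma radSq_add_smul (x e : EuclideanSpace ℝ (Fin n)) (s : ℝ) :
    radSq (x + s • e) = radSq x + 2 * s * (∑ i ∈ Finset.univ.erase (0 : Fin n), x i * e i) +
      s ^ 2 * radSq e := by
  simp only [radSq, Finset.mul_sum, ← Finset.sum_add_distrib]
  refine Finset.sum_congr rfl fun i _ => ?_
  simp
  ring

/-- First and second order conditions at a point where `σ (u - invGraph g)` is maximal. -/
lemma second_order_touching {u : EuclideanSpace ℝ (Fin n) → ℝ} (hsm : ContDiff ℝ (⊤ : ℕ∞) u)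
    {g g₁ : ℝ → ℝ} {g₂ σ : ℝ} (hσ : σ ≠ 0) {x : EuclideanSpace ℝ (Fin n)}
    (hg : ∀ᶠ t in nhds (x 0), 0 < g t ∧ HasDerivAt g (g₁ t) t) (hg₁ : HasDerivAt g₁ g₂ (x 0))
    (hmax : IsLocalMax (fun z => σ * (u z - invGraph g z)) x) (e : EuclideanSpace ℝ (Fin n)) :
    inner ℝ (gradient u x) e = (g (x 0) * g₁ (x 0) * e 0 +
      ∑ i ∈ Finset.univ.erase (0 : Fin n), x i * e i) / invGraph g x ∧
    σ * inner ℝ (fderiv ℝ (gradient u) x e) e ≤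
      σ * (((g₁ (x 0) ^ 2 + g (x 0) * g₂) * e 0 ^ 2 + radSq e -
        inner ℝ (gradient u x) e ^ 2) / invGraph g x) := by
  set B := ∑ i ∈ Finset.univ.erase (0 : Fin n), x i * e i with hB
  have hline : ∀ s : ℝ, HasDerivAt (fun s : ℝ => x + s • e) e s := fun s => by
    simpa using ((hasDerivAt_id s).smul_const e).const_add x
  have htau : ∀ s : ℝ, HasDerivAt (fun s : ℝ => x 0 + s * e 0) (e 0) s := fun s => by
    simpa using ((hasDerivAt_id s).mul_const (e 0)).const_add (x 0)
  have hcont : Filter.Tendsto (fun s : ℝ => x 0 + s * e 0) (nhds 0) (nhds (x 0)) := by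
    have := (htau 0).continuousAt.tendsto
    simpa using this
  set Φ : ℝ → ℝ := fun s => g (x 0 + s * e 0) ^ 2 + (radSq x + 2 * s * B + s ^ 2 * radSq e)
    with hΦ
  set N : ℝ → ℝ := fun s => g (x 0 + s * e 0) * g₁ (x 0 + s * e 0) * e 0 + B + s * radSq e with hN
  have hv : ∀ s, invGraph g (x + s • e) = Real.sqrt (Φ s) := fun s => by
    rw [invGraph, radSq_add_smul]; simp [hΦ, hB]
  have hΦpos : ∀ᶠ s in nhds (0 : ℝ), 0 < Φ s := by
    filter_upwards [hcont.eventually hg] with s hs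
    have := radSq_nonneg (x + s • e)
    rw [radSq_add_smul] at this
    have := pow_pos hs.1 2
    simp only [hΦ]; positivity
  have hΦd : ∀ᶠ s in nhds (0 : ℝ), HasDerivAt Φ (2 * N s) s := by
    filter_upwards [hcont.eventually hg] with s hs
    have h1 := (hs.2.comp s (htau s)).pow 2
    have h2 := (((hasDerivAt_id s).const_mul 2).mul_const B).const_add (radSq x)
    have h3 := ((hasDerivAt_id s).pow 2).mul_const (radSq e)
    refine (h1.add (h2.add h3)).congr_deriv ?_
    simp [hN]; ring
  have hsq : ∀ᶠ s in nhds (0 : ℝ),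
      HasDerivAt (fun s => Real.sqrt (Φ s)) (N s / Real.sqrt (Φ s)) s := by
    filter_upwards [hΦd, hΦpos] with s hs hp
    refine (hs.sqrt hp.ne').congr_deriv ?_
    have := (Real.sqrt_pos.mpr hp).ne'
    field_simp
  have hφ1 : ∀ᶠ s in nhds (0 : ℝ), HasDerivAt
      (fun s => σ * (u (x + s • e) - invGraph g (x + s • e)))
      (σ * (inner ℝ (gradient u (x + s • e)) e - N s / Real.sqrt (Φ s))) s := by
    filter_upwards [hsq] with s hs
    simp only [hv]
    refine HasDerivAt.const_mul _ (HasDerivAt.sub ?_ hs)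
    rw [inner_gradient_eq_fderiv]
    exact ((hsm.differentiable (by simp)) (x + s • e)).hasFDerivAt.comp_hasDerivAt s (hline s)
  have hN0 : HasDerivAt N ((g₁ (x 0) ^ 2 + g (x 0) * g₂) * e 0 ^ 2 + radSq e) 0 := by
    have hg0 : HasDerivAt g (g₁ (x 0)) (x 0 + 0 * e 0) := by simpa using hg.self_of_nhds.2
    have hg10 : HasDerivAt g₁ g₂ (x 0 + 0 * e 0) := by simpa using hg₁
    have h1 := ((hg0.comp 0 (htau 0)).mul (hg10.comp 0 (htau 0))).mul_const (e 0)
    have h2 := (h1.add_const B).add ((hasDerivAt_id (0:ℝ)).mul_const (radSq e))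
    refine h2.congr_deriv ?_
    simp; ring
  have hG0 : HasDerivAt (fun s : ℝ => inner ℝ (gradient u (x + s • e)) e)
      (inner ℝ (fderiv ℝ (gradient u) x e) e) 0 := by
    have h := (differentiable_gradient hsm (x + (0:ℝ) • e)).hasFDerivAt.comp_hasDerivAt (0:ℝ)
      (hline 0)
    simpa using h.inner ℝ (hasDerivAt_const (0:ℝ) e)
  have hs0 : Real.sqrt (Φ 0) = invGraph g x := by rw [← hv 0]; simp
  have hvpos : 0 < invGraph g x := hs0 ▸ Real.sqrt_pos.mpr hΦpos.self_of_nhds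
  have hφ2 := (hG0.sub (hN0.div hsq.self_of_nhds (by rw [hs0]; exact hvpos.ne'))).const_mul σ
  have hmax' : IsLocalMax (fun s : ℝ => σ * (u (x + s • e) - invGraph g (x + s • e))) 0 := by
    have hc : ContinuousAt (fun s : ℝ => x + s • e) 0 := (hline 0).continuousAt
    have h0 : IsLocalMax (fun z => σ * (u z - invGraph g z)) (x + (0:ℝ) • e) := by simpa using hmax
    exact IsLocalMax.comp_continuous (g := fun s : ℝ => x + s • e) h0 hc
  obtain ⟨ha, hb⟩ := hmax'.second_deriv_nonpos hφ1 hφ2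
  rw [hs0] at ha hb
  have hN00 : N 0 = g (x 0) * g₁ (x 0) * e 0 + B := by simp [hN]
  have ha' : inner ℝ (gradient u x) e = N 0 / invGraph g x := by
    have := (mul_eq_zero.mp ha).resolve_left hσ
    simp only [zero_smul, add_zero] at this
    linarith
  refine ⟨by rw [ha', hN00], ?_⟩
  rw [ha']
  refine le_of_sub_nonpos (le_of_eq_of_le ?_ hb)
  field_simp

/-- Comparison of mean curvatures at a point where `σ (u - invGraph g)` is maximal. -/
lemma touching_inequality {u : EuclideanSpace ℝ (Fin n) → ℝ} (hsm : ContDiff ℝ (⊤ : ℕ∞) u)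
    (hsp : ∀ x, ‖gradient u x‖ < 1)
    {g g₁ : ℝ → ℝ} {g₂ σ : ℝ} (hσ : σ ≠ 0) {x : EuclideanSpace ℝ (Fin n)}
    (hg : ∀ᶠ t in nhds (x 0), 0 < g t ∧ HasDerivAt g (g₁ t) t) (hg₁ : HasDerivAt g₁ g₂ (x 0))
    (hmax : IsLocalMax (fun z => σ * (u z - invGraph g z)) x) :
    σ * divg n (fun z => (Real.sqrt (1 - ‖gradient u z‖ ^ 2))⁻¹ • gradient u z) x ≤
      σ * (g₂ / Real.sqrt (1 - g₁ (x 0) ^ 2) ^ 3 +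
        ((n : ℝ) - 1) / (g (x 0) * Real.sqrt (1 - g₁ (x 0) ^ 2))) := by
  have key := second_order_touching hsm hσ hg hg₁ hmax
  rw [divg_gradient_eq hsm hsp]
  have hgpos := hg.self_of_nhds.1
  set G := gradient u x
  set L := fderiv ℝ (gradient u) x
  set a := g (x 0)
  set b := g₁ (x 0)
  set v := invGraph g x with hvdef
  set ρ := radSq x with hρ
  have hρ0 : 0 ≤ ρ := radSq_nonneg x
  have hv2 : v ^ 2 = a ^ 2 + ρ := by
    rw [hvdef, invGraph, Real.sq_sqrt]; positivity
  have hvpos : 0 < v := Real.sqrt_pos.mpr (by positivity)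
  have hp0 : G 0 = a * b / v := by
    have := (key (EuclideanSpace.single 0 1)).1
    rw [EuclideanSpace.inner_single_right] at this
    simp only [one_mul, conj_trivial] at this
    rw [this, Finset.sum_eq_zero]
    · simp
    · intro i hi
      simp [(Finset.mem_erase.mp hi).1]
  have hpi : ∀ i ∈ Finset.univ.erase (0 : Fin n), G i = x i / v := by
    intro i hi
    have h0 := (Finset.mem_erase.mp hi).1
    have := (key (EuclideanSpace.single i 1)).1
    rw [EuclideanSpace.inner_single_right] at this
    simp only [one_mul, conj_trivial] at this
    rw [this]
    simp [h0.symm, h0]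
  have hGr : radSq G = ρ / v ^ 2 := by
    rw [radSq, hρ, radSq, Finset.sum_div]
    exact Finset.sum_congr rfl fun i hi => by rw [hpi i hi, div_pow]
  have hP : ‖G‖ ^ 2 = (a * b / v) ^ 2 + ρ / v ^ 2 := by
    rw [norm_sq_eq_add_radSq, hGr, hp0]
  have hP1 : 0 < 1 - ‖G‖ ^ 2 := by nlinarith [hsp x, norm_nonneg G]
  have hPe : 1 - ‖G‖ ^ 2 = (a / v) ^ 2 * (1 - b ^ 2) := by
    rw [hP]; field_simp; rw [hv2]; ring
  have hb1 : 0 < 1 - b ^ 2 := by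
    rw [hPe] at hP1
    exact (pos_iff_pos_of_mul_pos hP1).mp (by positivity)
  have hW : Real.sqrt (1 - ‖G‖ ^ 2) = a / v * Real.sqrt (1 - b ^ 2) := by
    rw [hPe, Real.sqrt_mul (by positivity), Real.sqrt_sq (by positivity)]
  set s := Real.sqrt (1 - b ^ 2) with hs
  have hs2 : s ^ 2 = 1 - b ^ 2 := Real.sq_sqrt hb1.le
  have hspos : 0 < s := Real.sqrt_pos.mpr hb1
  have hsum : σ * (∑ i, inner ℝ (L (EuclideanSpace.single i 1)) (EuclideanSpace.single i 1)) ≤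
      σ * (((b ^ 2 + a * g₂) + (n - 1) - ‖G‖ ^ 2) / v) := by
    rw [Finset.mul_sum]
    refine (Finset.sum_le_sum fun i _ => (key (EuclideanSpace.single i 1)).2).trans_eq ?_
    rw [← Finset.mul_sum, ← Finset.sum_div]
    congr 2
    have h2 : ∀ i : Fin n, (EuclideanSpace.single i (1:ℝ) : EuclideanSpace ℝ (Fin n)) 0 ^ 2 =
        if i = 0 then 1 else 0 := fun i => by
      by_cases h : i = 0
      · simp [h]
      · simp [h, Ne.symm h]
    have hr : ∀ i : Fin n, radSq (EuclideanSpace.single i (1:ℝ) : EuclideanSpace ℝ (Fin n)) =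
        1 - (if i = 0 then 1 else 0) := fun i => by
      have := norm_sq_eq_add_radSq (EuclideanSpace.single i (1:ℝ))
      rw [h2, PiLp.norm_single, norm_one] at this
      linarith
    simp only [hr, h2, Finset.sum_sub_distrib, Finset.sum_add_distrib, ← Finset.mul_sum,
      EuclideanSpace.inner_single_right, EuclideanSpace.real_norm_sq_eq]
    simp
  have hpp : σ * inner ℝ (L G) G ≤ σ * (((b ^ 2 + a * g₂) * (a * b / v) ^ 2 + ρ / v ^ 2 -
      (‖G‖ ^ 2) ^ 2) / v) := by
    have := (key G).2
    rwa [hGr, real_inner_self_eq_norm_sq, hp0] at this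
  rw [hW]
  have hWi : 0 < (a / v * s)⁻¹ := by positivity
  calc _ = (a / v * s)⁻¹ * (σ * (∑ i, inner ℝ (L (EuclideanSpace.single i 1))
          (EuclideanSpace.single i 1))) + (a / v * s)⁻¹ ^ 3 * (σ * inner ℝ (L G) G) := by ring
    _ ≤ (a / v * s)⁻¹ * (σ * (((b ^ 2 + a * g₂) + (n - 1) - ‖G‖ ^ 2) / v)) +
        (a / v * s)⁻¹ ^ 3 * (σ * (((b ^ 2 + a * g₂) * (a * b / v) ^ 2 + ρ / v ^ 2 -
        (‖G‖ ^ 2) ^ 2) / v)) := by gcongr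
    _ = _ := by
      have hPv : ‖G‖ ^ 2 = 1 - (a / v) ^ 2 * s ^ 2 := by rw [hs2]; linarith
      have hρe : ρ = v ^ 2 - a ^ 2 := by linarith
      have hbe : b ^ 2 = 1 - s ^ 2 := by linarith
      have hbe4 : (a * b / v) ^ 2 = a ^ 2 * (1 - s ^ 2) / v ^ 2 := by rw [← hbe]; ring
      rw [hPv, hρe, hbe4, hbe]
      field_simp
      ring

end Touching

section Comparison

variable {n : ℕ} [NeZero n]

lemma continuous_invGraph {g : ℝ → ℝ} (hg : Continuous g) :
    Continuous (invGraph g : EuclideanSpace ℝ (Fin n) → ℝ) := by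
  have := continuous_radSq (n := n)
  unfold invGraph
  fun_prop

/-- Comparison of a solution with invariant strict supersolutions (`σ = 1`) and strict
subsolutions (`σ = -1`). -/
lemma comparison_invGraph {u : EuclideanSpace ℝ (Fin n) → ℝ} (hsm : ContDiff ℝ (⊤ : ℕ∞) u)
    (hsp : ∀ x, ‖gradient u x‖ < 1)
    (hmc : ∀ x, divg n (fun z => (Real.sqrt (1 - ‖gradient u z‖ ^ 2))⁻¹ • gradient u z) x = n)
    {g g₁ g₂ : ℝ → ℝ} {σ : ℝ} (hσ : σ ≠ 0) {I : Set ℝ} (hI : IsOpen I) (hgc : Continuous g)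
    (hpos : ∀ t ∈ I, 0 < g t) (hg : ∀ t ∈ I, HasDerivAt g (g₁ t) t)
    (hg₁ : ∀ t ∈ I, HasDerivAt g₁ (g₂ t) t)
    (hH : ∀ t ∈ I, σ * (g₂ t / Real.sqrt (1 - g₁ t ^ 2) ^ 3 +
      ((n : ℝ) - 1) / (g t * Real.sqrt (1 - g₁ t ^ 2))) < σ * n)
    (hout : ∀ x : EuclideanSpace ℝ (Fin n), x 0 ∉ I → σ * (u x - invGraph g x) ≤ 0)
    (hfar : ∀ ε > 0, ∃ R : ℝ, ∀ x : EuclideanSpace ℝ (Fin n), x 0 ∈ I → R ≤ ‖x‖ →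
      σ * (u x - invGraph g x) ≤ ε) (x : EuclideanSpace ℝ (Fin n)) :
    σ * (u x - invGraph g x) ≤ 0 := by
  by_contra! hx
  have hc : Continuous fun z => σ * (u z - invGraph g z) :=
    continuous_const.mul (hsm.continuous.sub (continuous_invGraph hgc))
  obtain ⟨R, hR⟩ := hfar _ hx
  obtain ⟨y, hy⟩ := hc.exists_forall_ge' x (by
    filter_upwards [tendsto_norm_cocompact_atTop.eventually (eventually_ge_atTop R)] with z hz
    by_cases h : z 0 ∈ I
    · exact hR z h hz
    · exact (hout z h).trans hx.le)
  have hyI : y 0 ∈ I := by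
    by_contra h
    exact absurd (hx.trans_le (hy x)) (hout y h).not_gt
  have := touching_inequality hsm hsp hσ
    (by filter_upwards [hI.mem_nhds hyI] with t ht using ⟨hpos t ht, hg t ht⟩)
    (hg₁ _ hyI) (Filter.Eventually.of_forall hy)
  rw [hmc] at this
  exact absurd (hH _ hyI) this.not_gt

end Comparison

lemma sqrt_sq_add_le {A B : ℝ} (hA : 0 < A) (hB : 0 ≤ B) :
    Real.sqrt (A ^ 2 + B) ≤ A + B / (2 * A) := by
  apply Real.sqrt_le_iff.mpr
  refine ⟨by positivity, ?_⟩
  have : (A + B / (2 * A)) ^ 2 = A ^ 2 + B + (B / (2 * A)) ^ 2 := by field_simp; ring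
  nlinarith [sq_nonneg (B / (2 * A))]

section Bounds

variable {n : ℕ} [NeZero n]

lemma abs_sub_le_norm_of_spacelike {n : ℕ} {u : EuclideanSpace ℝ (Fin n) → ℝ}
    (hsm : ContDiff ℝ (⊤ : ℕ∞) u) (hsp : ∀ x, ‖gradient u x‖ < 1)
    (x y : EuclideanSpace ℝ (Fin n)) : |u x - u y| ≤ ‖x - y‖ := by
  have := Convex.norm_image_sub_le_of_norm_fderiv_le (𝕜 := ℝ) (f := u) (C := 1) (s := Set.univ)
    (x := y) (y := x) (fun z _ => hsm.differentiable (by simp) z) (fun z _ => by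
      have := hsp z
      simp only [gradient, LinearIsometryEquiv.norm_map] at this
      exact this.le) convex_univ trivial trivial
  simpa using this

lemma le_norm_sub_smul {n : ℕ} {x l : EuclideanSpace ℝ (Fin n)} (hl : ‖l‖ = 1) {ε : ℝ}
    (hε : 0 < ε) :
    ∀ᶠ τ : ℝ in atTop, ‖x - τ • l‖ ≤ τ - inner ℝ x l + ε := by
  set p := inner ℝ x l with hp
  filter_upwards [eventually_gt_atTop p, eventually_ge_atTop (p + ‖x‖ ^ 2 / (2 * ε))] with τ h1 h2
  have hA : 0 < τ - p := by linarith
  have hB : 0 ≤ ‖x‖ ^ 2 - p ^ 2 := by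
    have : |p| ≤ ‖x‖ := by simpa [hl] using abs_real_inner_le_norm x l
    nlinarith [sq_abs p, abs_nonneg p]
  have hn : ‖x - τ • l‖ = Real.sqrt ((τ - p) ^ 2 + (‖x‖ ^ 2 - p ^ 2)) := by
    rw [← Real.sqrt_sq (norm_nonneg (x - τ • l)), norm_sub_sq_real, real_inner_smul_right,
      norm_smul, hl, ← hp]
    congr 1
    simp
    ring
  rw [hn]
  refine (sqrt_sq_add_le hA hB).trans ?_
  have : (‖x‖ ^ 2 - p ^ 2) / (2 * (τ - p)) ≤ ε := by
    rw [div_le_iff₀ (by linarith)]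
    have : ‖x‖ ^ 2 / (2 * ε) ≤ τ - p := by linarith
    rw [div_le_iff₀ (by linarith)] at this
    nlinarith [sq_nonneg p]
  linarith

lemma inner_le_of_asymptotic {u : EuclideanSpace ℝ (Fin n) → ℝ}
    (hlip : ∀ x y, |u x - u y| ≤ ‖x - y‖)
    (h1 : ∀ ε > (0 : ℝ), ∃ R : ℝ, ∀ x : EuclideanSpace ℝ (Fin n),
      R ≤ ‖x‖ → 0 ≤ x 0 → |u x - ‖x‖| < ε)
    (x l : EuclideanSpace ℝ (Fin n)) (hl : ‖l‖ = 1) (hl0 : 0 ≤ l 0) : inner ℝ x l ≤ u x := by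
  refine le_of_forall_pos_le_add fun ε hε => ?_
  obtain ⟨R, hR⟩ := h1 (ε / 2) (by positivity)
  obtain ⟨τ, h2, h3, h4⟩ := ((le_norm_sub_smul (x := x) hl (half_pos hε)).and
    ((eventually_ge_atTop R).and (eventually_ge_atTop 0))).exists
  have hn : ‖τ • l‖ = τ := by rw [norm_smul, hl, mul_one, Real.norm_of_nonneg h4]
  have h5 := hR (τ • l) (by rwa [hn]) (by simpa using mul_nonneg h4 hl0)
  rw [hn] at h5
  have h6 := hlip x (τ • l)
  rw [abs_lt] at h5
  rw [abs_le] at h6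
  linarith

lemma norm_le_of_asymptotic {u : EuclideanSpace ℝ (Fin n) → ℝ}
    (hlip : ∀ x y, |u x - u y| ≤ ‖x - y‖)
    (h1 : ∀ ε > (0 : ℝ), ∃ R : ℝ, ∀ x : EuclideanSpace ℝ (Fin n),
      R ≤ ‖x‖ → 0 ≤ x 0 → |u x - ‖x‖| < ε)
    {x : EuclideanSpace ℝ (Fin n)} (hx : 0 ≤ x 0) : ‖x‖ ≤ u x := by
  by_cases h : x = 0
  · have := inner_le_of_asymptotic hlip h1 x (EuclideanSpace.single 0 1) (by simp) (by simp)
    simpa [h] using this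
  · have hn : 0 < ‖x‖ := norm_pos_iff.mpr h
    have := inner_le_of_asymptotic hlip h1 x (‖x‖⁻¹ • x)
      (by rw [norm_smul, norm_inv, norm_norm, inv_mul_cancel₀ hn.ne'])
      (by simpa using mul_nonneg (inv_nonneg.mpr hn.le) hx)
    rwa [real_inner_smul_right, real_inner_self_eq_norm_sq, pow_two, inv_mul_cancel_left₀ hn.ne']
      at this

lemma exists_eq_add_smul (hn : 2 ≤ n) (x : EuclideanSpace ℝ (Fin n)) :
    ∃ e : EuclideanSpace ℝ (Fin n), ‖e‖ = 1 ∧ e 0 = 0 ∧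
      x = x 0 • EuclideanSpace.single 0 1 + Real.sqrt (radSq x) • e := by
  have hx0 : (x - x 0 • EuclideanSpace.single (0 : Fin n) (1 : ℝ)) 0 = 0 := by simp
  have hnorm : ‖x - x 0 • EuclideanSpace.single (0 : Fin n) (1 : ℝ)‖ = Real.sqrt (radSq x) := by
    rw [← Real.sqrt_sq (norm_nonneg (x - _)), norm_sq_eq_add_radSq, hx0, radSq, radSq]
    congr 1
    rw [zero_pow two_ne_zero, zero_add]
    refine Finset.sum_congr rfl fun i hi => ?_
    simp [(Finset.mem_erase.mp hi).1]
  by_cases h : Real.sqrt (radSq x) = 0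
  · refine ⟨EuclideanSpace.single ⟨1, hn⟩ 1, by simp, ?_, ?_⟩
    · have : (0 : Fin n) ≠ ⟨1, hn⟩ := by
        intro h
        have := congrArg Fin.val h
        simp at this
      simp [this]
    · rw [h, norm_eq_zero, sub_eq_zero] at hnorm
      rw [h, zero_smul, add_zero]
      exact hnorm
  · refine ⟨(Real.sqrt (radSq x))⁻¹ • (x - x 0 • EuclideanSpace.single (0 : Fin n) (1 : ℝ)), ?_,
      ?_, ?_⟩
    · rw [norm_smul, hnorm, norm_inv, Real.norm_of_nonneg (Real.sqrt_nonneg _), inv_mul_cancel₀ h]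
    · rw [PiLp.smul_apply, hx0, smul_zero]
    · rw [smul_inv_smul₀ h]; abel

lemma sqrt_radSq_le_of_asymptotic (hn : 2 ≤ n) {u : EuclideanSpace ℝ (Fin n) → ℝ}
    (hlip : ∀ x y, |u x - u y| ≤ ‖x - y‖)
    (h1 : ∀ ε > (0 : ℝ), ∃ R : ℝ, ∀ x : EuclideanSpace ℝ (Fin n),
      R ≤ ‖x‖ → 0 ≤ x 0 → |u x - ‖x‖| < ε)
    (x : EuclideanSpace ℝ (Fin n)) : Real.sqrt (radSq x) ≤ u x := by
  obtain ⟨e, he, he0, hx⟩ := exists_eq_add_smul hn x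
  have h := inner_le_of_asymptotic hlip h1 x e he he0.ge
  have h2 : inner ℝ x e = Real.sqrt (radSq x) := by
    conv_lhs => rw [hx]
    rw [inner_add_left, real_inner_smul_left, real_inner_smul_left, real_inner_self_eq_norm_sq,
      he, EuclideanSpace.inner_single_left]
    simp [he0]
  rwa [h2] at h

lemma le_sqrt_radSq_add_of_asymptotic (hn : 2 ≤ n) {u : EuclideanSpace ℝ (Fin n) → ℝ}
    (hlip : ∀ x y, |u x - u y| ≤ ‖x - y‖)
    (h1 : ∀ ε > (0 : ℝ), ∃ R : ℝ, ∀ x : EuclideanSpace ℝ (Fin n),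
      R ≤ ‖x‖ → 0 ≤ x 0 → |u x - ‖x‖| < ε)
    (h2 : ∀ ε > (0 : ℝ), ∃ R > (0 : ℝ), ∀ x : EuclideanSpace ℝ (Fin n),
      x 0 ≤ -R → R ≤ Real.sqrt (radSq x) → |u x - Real.sqrt (radSq x)| < ε)
    {ε : ℝ} (hε : 0 < ε) : ∃ R : ℝ, ∀ x : EuclideanSpace ℝ (Fin n), x 0 ≤ 0 →
      R ≤ Real.sqrt (radSq x) → u x ≤ Real.sqrt (radSq x) + ε := by
  obtain ⟨R₁, hR₁⟩ := h1 (ε / 2) (by positivity)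
  obtain ⟨R₂, hR₂0, hR₂⟩ := h2 ε hε
  refine ⟨max R₂ (max (2 * R₁) (2 * R₂ ^ 2 / ε)), fun x hx hr => ?_⟩
  simp only [max_le_iff] at hr
  obtain ⟨hr2, hr1, hr3⟩ := hr
  by_cases hx2 : x 0 ≤ -R₂
  · have := (abs_lt.mp (hR₂ x hx2 hr2)).2
    linarith
  obtain ⟨e, he, he0, hxe⟩ := exists_eq_add_smul hn x
  set r := Real.sqrt (radSq x) with hrdef
  have hrpos : 0 < r := hR₂0.trans_le hr2
  have hny : ‖(r / 2) • e‖ = r / 2 := by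
    rw [norm_smul, he, mul_one, Real.norm_of_nonneg (by positivity)]
  have h3 := (abs_lt.mp (hR₁ ((r / 2) • e) (by rw [hny]; linarith) (by simp [he0]))).2
  rw [hny] at h3
  have h4 := (abs_le.mp (hlip x ((r / 2) • e))).2
  have h5 : ‖x - (r / 2) • e‖ = Real.sqrt ((r / 2) ^ 2 + x 0 ^ 2) := by
    have : x - (r / 2) • e = x 0 • EuclideanSpace.single 0 1 + (r / 2) • e := by
      conv_lhs => rw [hxe]
      rw [add_sub_assoc, ← sub_smul]; ring_nf
    rw [this, ← Real.sqrt_sq (norm_nonneg (_ + _)), norm_add_sq_real, real_inner_smul_left,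
      real_inner_smul_right, EuclideanSpace.inner_single_left, norm_smul, hny, he0]
    congr 1
    simp; ring
  have h6 := sqrt_sq_add_le (A := r / 2) (B := x 0 ^ 2) (by positivity) (by positivity)
  have h7 : x 0 ^ 2 / (2 * (r / 2)) ≤ ε / 2 := by
    rw [div_le_iff₀ (by positivity)]
    rw [div_le_iff₀ hε] at hr3
    push Not at hx2
    nlinarith
  linarith

end Bounds

section Profile

/-- Inverting a time map `T` with `T' = 1/F` solves `f' = F(f)` on the whole line. -/
lemma exists_solution_of_timeMap {a : ℝ} {F T : ℝ → ℝ} (hF : ∀ y, a < y → 0 < F y)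
    (hT : ∀ y, a < y → HasDerivAt T (F y)⁻¹ y) (hbot : Tendsto T (nhdsWithin a (Set.Ioi a)) atBot)
    (htop : Tendsto T atTop atTop) :
    ∃ f : ℝ → ℝ, (∀ t, a < f t) ∧ (∀ t, T (f t) = t) ∧ (∀ t, HasDerivAt f (F (f t)) t) ∧
      Tendsto f atBot (nhds a) := by
  have hmono : StrictMonoOn T (Set.Ioi a) := by
    apply strictMonoOn_of_deriv_pos (convex_Ioi a)
    · exact fun y hy => (hT y hy).continuousAt.continuousWithinAt
    · intro y hy
      rw [interior_Ioi] at hy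
      rw [(hT y hy).deriv]
      exact inv_pos.mpr (hF y hy)
  have hlt : ∀ s : ℝ, a < a + Real.exp s := fun s => by linarith [Real.exp_pos s]
  set S : ℝ → ℝ := fun s => T (a + Real.exp s) with hS
  have hSm : StrictMono S := fun s t hst => hmono (hlt s) (hlt t) (by simpa using hst)
  have hSc : Continuous S := by
    rw [continuous_iff_continuousAt]
    intro s
    exact ContinuousAt.comp (f := fun s => a + Real.exp s) (hT _ (hlt s)).continuousAt
      (by fun_prop)
  have hStop : Tendsto S atTop atTop :=
    htop.comp (tendsto_atTop_add_const_left _ _ Real.tendsto_exp_atTop)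
  have hSbot : Tendsto S atBot atBot := by
    refine hbot.comp (tendsto_nhdsWithin_iff.mpr ⟨?_, Filter.Eventually.of_forall hlt⟩)
    simpa using Real.tendsto_exp_atBot.const_add a
  set e := hSm.orderIsoOfSurjective S (hSc.surjective hStop hSbot) with he
  have heS : ∀ t, S (e.symm t) = t := fun t => e.apply_symm_apply t
  have hTf : ∀ t, T (a + Real.exp (e.symm t)) = t := heS
  refine ⟨fun t => a + Real.exp (e.symm t), fun t => hlt _, hTf, fun t => ?_, ?_⟩
  · have hc : Continuous fun t => a + Real.exp (e.symm t) :=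
      continuous_const.add (Real.continuous_exp.comp e.symm.continuous)
    have := HasDerivAt.of_local_left_inverse (hc.continuousAt (x := t)) (hT _ (hlt _))
      (inv_pos.mpr (hF _ (hlt _))).ne' (Filter.Eventually.of_forall hTf)
    simpa using this
  · have : Tendsto e.symm atBot atBot := e.symm.tendsto_atBot
    simpa using (Real.tendsto_exp_atBot.comp this).const_add a

lemma tendsto_self_sub_sqrt_sq_sub_one :
    Tendsto (fun y : ℝ => y - Real.sqrt (y ^ 2 - 1)) atTop (nhds 0) := by
  refine squeeze_zero' (g := fun y : ℝ => y⁻¹) ?_ ?_ tendsto_inv_atTop_zero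
  · filter_upwards [eventually_ge_atTop 0] with y hy
    have : Real.sqrt (y ^ 2 - 1) ≤ y := Real.sqrt_le_iff.mpr ⟨hy, by linarith⟩
    linarith
  · filter_upwards [eventually_ge_atTop 1] with y hy
    have : y - y⁻¹ ≤ Real.sqrt (y ^ 2 - 1) := by
      apply Real.le_sqrt_of_sq_le
      have h0 : (0:ℝ) < y := by linarith
      have h1 : y * y⁻¹ = 1 := mul_inv_cancel₀ h0.ne'
      have h2 : y⁻¹ ≤ 1 := inv_le_one_of_one_le₀ hy
      have h3 : 0 < y⁻¹ := by positivity
      nlinarith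
    linarith

/-- A normalised time map for a speed `F < 1` that is asymptotically faster than that of the
hyperbola and vanishes to first order at `a`. -/
lemma exists_timeMap {a K : ℝ} {F : ℝ → ℝ} (ha : a < 1) (hK : 0 < K)
    (hFc : ∀ y, a < y → ContinuousAt F y)
    (hF : ∀ y, a < y → 0 < F y) (hF1 : ∀ y, a < y → F y < 1)
    (hFK : ∀ y, a < y → F y ≤ K * (y - a))
    (hFh : ∀ y, 1 < y → Real.sqrt (y ^ 2 - 1) / y < F y) :
    ∃ T : ℝ → ℝ, (∀ y, a < y → HasDerivAt T (F y)⁻¹ y) ∧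
      Tendsto T (nhdsWithin a (Set.Ioi a)) atBot ∧ Tendsto T atTop atTop ∧
      (∀ y, a < y → T y < y) ∧ (∀ y, 1 ≤ y → Real.sqrt (y ^ 2 - 1) < T y) := by
  set T₀ : ℝ → ℝ := fun y => ∫ z in (1:ℝ)..y, (F z)⁻¹ with hT₀
  have hd : ∀ y, a < y → HasDerivAt T₀ (F y)⁻¹ y := by
    intro y hy
    have hc : ContinuousOn (fun z => (F z)⁻¹) (Set.Ioi a) := fun z hz =>
      ((hFc z hz).inv₀ (hF z hz).ne').continuousWithinAt
    apply intervalIntegral.integral_hasDerivAt_right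
    · refine (hc.mono fun z hz => ?_).intervalIntegrable
      exact (lt_min ha hy).trans_le hz.1
    · exact hc.stronglyMeasurableAtFilter isOpen_Ioi y hy
    · exact (hFc y hy).inv₀ (hF y hy).ne'
  have hT01 : T₀ 1 = 0 := intervalIntegral.integral_same
  have hinv1 : ∀ y, a < y → 1 < (F y)⁻¹ := fun y hy => (one_lt_inv₀ (hF y hy)).mpr (hF1 y hy)
  have hm : StrictMonoOn (fun y => T₀ y - y) (Set.Ioi a) := by
    apply strictMonoOn_of_deriv_pos (convex_Ioi a)
    · exact fun y hy => ((hd y hy).continuousAt.sub continuousAt_id).continuousWithinAt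
    · intro y hy
      rw [interior_Ioi] at hy
      rw [((hd y hy).fun_sub (hasDerivAt_id' y)).deriv]
      linarith [hinv1 y hy]
  have hanti : StrictAntiOn (fun y => T₀ y - Real.sqrt (y ^ 2 - 1)) (Set.Ici 1) := by
    apply strictAntiOn_of_deriv_neg (convex_Ici 1)
    · intro y hy
      have hy' : a < y := ha.trans_le hy
      have : ContinuousAt (fun y : ℝ => Real.sqrt (y ^ 2 - 1)) y := by fun_prop
      exact ((hd y hy').continuousAt.sub this).continuousWithinAt
    · intro y hy
      rw [interior_Ici] at hy
      have hy1 : (1:ℝ) < y := hy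
      have hpos : 0 < y ^ 2 - 1 := by nlinarith
      have hs := Real.sqrt_pos.mpr hpos
      have h1 := (((hasDerivAt_id y).pow 2).sub_const 1).sqrt hpos.ne'
      have h2 := (hd y (ha.trans hy1)).sub h1
      have h3 : (F y)⁻¹ < y / Real.sqrt (y ^ 2 - 1) := by
        rw [← inv_div]
        exact inv_strictAnti₀ (by positivity) (hFh y hy1)
      have h4 : deriv (fun y => T₀ y - Real.sqrt (y ^ 2 - 1)) y =
          (F y)⁻¹ - y / Real.sqrt (y ^ 2 - 1) := by
        refine h2.deriv.trans ?_
        simp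
        field_simp
      rw [h4]
      linarith
  have hbdd : ∀ y, 1 ≤ y → T₀ y - y ≤ 0 := by
    intro y hy
    have h := hanti.antitoneOn (Set.mem_Ici.mpr le_rfl) hy hy
    simp only [hT01] at h
    have : Real.sqrt (y ^ 2 - 1) ≤ y := Real.sqrt_le_iff.mpr ⟨by linarith, by linarith⟩
    norm_num at h
    linarith
  obtain ⟨l, hl⟩ : ∃ l, Tendsto (fun y => T₀ y - y) atTop (nhds l) := by
    have hmono : Monotone fun y => T₀ (max y 1) - max y 1 := fun y z hyz =>
      hm.monotoneOn (ha.trans_le (le_max_right y 1)) (ha.trans_le (le_max_right z 1))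
        (max_le_max_right 1 hyz)
    have := tendsto_atTop_ciSup hmono ⟨0, by
      rintro _ ⟨y, rfl⟩
      exact hbdd _ (le_max_right y 1)⟩
    refine ⟨_, this.congr' ?_⟩
    filter_upwards [eventually_ge_atTop 1] with y hy
    rw [max_eq_left hy]
  have hl2 : Tendsto (fun y => T₀ y - Real.sqrt (y ^ 2 - 1)) atTop (nhds l) := by
    have := hl.add tendsto_self_sub_sqrt_sq_sub_one
    simpa using this
  refine ⟨fun y => T₀ y - l, fun y hy => (hd y hy).sub_const l, ?_, ?_, ?_, ?_⟩
  · have hKm : MonotoneOn (fun y => T₀ y - K⁻¹ * Real.log (y - a)) (Set.Ioi a) := by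
      have hder : ∀ y, a < y → HasDerivAt (fun y => T₀ y - K⁻¹ * Real.log (y - a))
          ((F y)⁻¹ - K⁻¹ * (1 / (y - a))) y := fun y hy =>
        (hd y hy).sub ((((hasDerivAt_id y).sub_const a).log (by simp; linarith)).const_mul K⁻¹)
      apply monotoneOn_of_deriv_nonneg (convex_Ioi a)
      · exact fun y hy => (hder y hy).continuousAt.continuousWithinAt
      · rw [interior_Ioi]
        exact fun y hy => (hder y hy).differentiableAt.differentiableWithinAt
      · intro y hy
        rw [interior_Ioi] at hy
        rw [(hder y hy).deriv, one_div, ← mul_inv, sub_nonneg]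
        exact inv_anti₀ (hF y hy) (hFK y hy)
    have hlog : Tendsto (fun y => K⁻¹ * Real.log (y - a) +
        ((T₀ 1 - K⁻¹ * Real.log (1 - a)) - l)) (nhdsWithin a (Set.Ioi a)) atBot := by
      refine tendsto_atBot_add_const_right _ _ (Tendsto.const_mul_atBot (by positivity) ?_)
      refine Real.tendsto_log_nhdsGT_zero.comp (tendsto_nhdsWithin_iff.mpr ⟨?_, ?_⟩)
      · have : Tendsto (fun y : ℝ => y - a) (nhds a) (nhds (a - a)) := tendsto_id.sub_const a
        rw [sub_self] at this
        exact this.mono_left nhdsWithin_le_nhds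
      · filter_upwards [self_mem_nhdsWithin] with y hy
        exact sub_pos.mpr (Set.mem_Ioi.mp hy)
    refine tendsto_atBot_mono' _ ?_ hlog
    filter_upwards [self_mem_nhdsWithin, nhdsWithin_le_nhds (Iio_mem_nhds ha)] with y hy hy1
    have := hKm hy (show (1:ℝ) ∈ Set.Ioi a from ha) (le_of_lt hy1)
    simp only at this
    linarith
  · refine ((hl.sub_const l).add_atTop tendsto_id).congr fun y => ?_
    simp only [id]; ring
  · intro y hy
    have h1 := hm hy (show y + 1 ∈ Set.Ioi a by simp at hy ⊢; linarith) (lt_add_one y)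
    have h2 : T₀ (y + 1) - (y + 1) ≤ l := by
      refine ge_of_tendsto hl ?_
      filter_upwards [eventually_ge_atTop (y + 1)] with z hz
      exact hm.monotoneOn (show y + 1 ∈ Set.Ioi a by simp at hy ⊢; linarith)
        (show z ∈ Set.Ioi a by simp at hy ⊢; linarith) hz
    simp only at h1
    linarith
  · intro y hy
    have h1 := hanti hy (show y + 1 ∈ Set.Ici (1:ℝ) by simp; linarith) (lt_add_one y)
    have h2 : l ≤ T₀ (y + 1) - Real.sqrt ((y + 1) ^ 2 - 1) := by
      refine le_of_tendsto hl2 ?_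
      filter_upwards [eventually_ge_atTop (y + 1)] with z hz
      exact hanti.antitoneOn (show y + 1 ∈ Set.Ici (1:ℝ) by simp; linarith)
        (show z ∈ Set.Ici (1:ℝ) by simp; linarith) hz
    simp only at h1
    linarith

/-- The semitrough profile, with its first two derivatives. -/
lemma exists_semitrough_profile (n : ℕ) (hn : 2 ≤ n) :
    ∃ f f₁ f₂ : ℝ → ℝ, (∀ t, HasDerivAt f (f₁ t) t) ∧ (∀ t, HasDerivAt f₁ (f₂ t) t) ∧
      Continuous f₂ ∧ (∀ t, 0 < f₁ t ∧ f₁ t < 1 ∧ 0 < f₂ t) ∧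
      (∀ t, ((n : ℝ) - 1) / n < f t ∧ t < f t ∧ f t < Real.sqrt (1 + t ^ 2)) ∧
      Tendsto f atBot (nhds (((n : ℝ) - 1) / n)) ∧
      ∀ t, f₂ t / Real.sqrt (1 - f₁ t ^ 2) ^ 3 +
        ((n : ℝ) - 1) / (f t * Real.sqrt (1 - f₁ t ^ 2)) = n := by
  obtain ⟨m, rfl⟩ : ∃ m, n = m + 1 := ⟨n - 1, by omega⟩
  have hm0 : (0:ℝ) < m := by
    have : 0 < m := by omega
    exact_mod_cast this
  push_cast
  simp only [add_sub_cancel_right]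
  obtain ⟨a, ha⟩ : ∃ a : ℝ, a = (m : ℝ) / (m + 1) := ⟨_, rfl⟩
  rw [← ha]
  have ha0 : 0 < a := by rw [ha]; positivity
  have ha1 : a < 1 := by rw [ha, div_lt_one (by positivity)]; linarith
  have hapow : a ^ (m + 1) = a ^ m * (m / (m + 1)) := by rw [pow_succ, ← ha]
  set q : ℝ → ℝ := fun y => y + a ^ m / (m + 1) * (y ^ m)⁻¹ with hq
  set q' : ℝ → ℝ := fun y => 1 - (a / y) ^ (m + 1) with hq'
  have hqd : ∀ y, a < y → HasDerivAt q (q' y) y := by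
    intro y hy
    have hy0 : y ≠ 0 := (ha0.trans hy).ne'
    have h := (hasDerivAt_id y).add ((((hasDerivAt_id y).pow m).inv
      (pow_ne_zero m hy0)).const_mul (a ^ m / (m + 1)))
    refine h.congr_deriv ?_
    obtain ⟨k, rfl⟩ : ∃ k, m = k + 1 := ⟨m - 1, by omega⟩
    simp only [hq', id, Nat.add_sub_cancel, Pi.pow_apply]
    rw [div_pow, hapow]
    push_cast
    field_simp
    ring
  have hqa : q a = 1 := by
    simp only [hq]
    rw [mul_comm, ← mul_div_assoc, inv_mul_cancel₀ (pow_pos ha0 m).ne', ha]; field_simp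
  have hq'pos : ∀ y, a < y → 0 < q' y := fun y hy =>
    sub_pos.mpr (pow_lt_one₀ (by have := ha0.trans hy; positivity)
      ((div_lt_one (ha0.trans hy)).mpr hy) (by omega))
  have hq'le : ∀ y, a < y → q' y ≤ (m + 1) / a * (y - a) := by
    intro y hy
    have hy0 := ha0.trans hy
    have h1 : a / y - 1 = -((y - a) / y) := by field_simp; ring
    have h2 : (y - a) / y ≤ (y - a) / a := by
      have : 0 < y - a := by linarith
      gcongr
    have h3 : (y - a) / y ≤ 1 := (div_le_one hy0).mpr (by linarith)
    have h := one_add_mul_le_pow (a := a / y - 1) (by rw [h1]; linarith) (m + 1)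
    rw [add_sub_cancel, h1] at h
    push_cast at h
    have h4 : (m + 1) / a * (y - a) = (m + 1) * ((y - a) / a) := by ring
    have h5 : (m + 1) * ((y - a) / y) ≤ ((m : ℝ) + 1) * ((y - a) / a) := by gcongr
    simp only [hq']
    linarith
  have hqc : ContinuousOn q (Set.Ici a) := by
    intro y hy
    have : y ^ m ≠ 0 := pow_ne_zero _ (ha0.trans_le hy).ne'
    have h : ContinuousAt q y := by simp only [hq]; fun_prop (disch := assumption)
    exact h.continuousWithinAt
  have hq1 : ∀ y, a < y → 1 < q y := by
    have : StrictMonoOn q (Set.Ici a) := by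
      apply strictMonoOn_of_deriv_pos (convex_Ici a) hqc
      intro y hy
      rw [interior_Ici] at hy
      rw [(hqd y hy).deriv]
      exact hq'pos y hy
    intro y hy
    rw [← hqa]
    exact this (Set.mem_Ici.mpr le_rfl) hy.le hy
  have hqle : ∀ y, a < y → q y - 1 ≤ (m + 1) / (2 * a) * (y - a) ^ 2 := by
    have hder : ∀ y, a < y → HasDerivAt (fun y => (m + 1) / (2 * a) * (y - a) ^ 2 - q y)
        ((m + 1) / a * (y - a) - q' y) y := fun y hy => by
      refine (((((hasDerivAt_id' y).sub_const a).fun_pow 2).const_mul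
        ((m + 1) / (2 * a))).fun_sub (hqd y hy)).congr_deriv ?_
      simp; field_simp
    have : MonotoneOn (fun y => (m + 1) / (2 * a) * (y - a) ^ 2 - q y) (Set.Ici a) := by
      apply monotoneOn_of_deriv_nonneg (convex_Ici a)
      · exact ContinuousOn.sub (by fun_prop) hqc
      · rw [interior_Ici]
        exact fun y hy => (hder y hy).differentiableAt.differentiableWithinAt
      · intro y hy
        rw [interior_Ici] at hy
        rw [(hder y hy).deriv]
        linarith [hq'le y hy]
    intro y hy
    have h := this (Set.mem_Ici.mpr le_rfl) (Set.mem_Ici.mpr hy.le) hy.le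
    simp only [sub_self, hqa] at h
    norm_num at h
    linarith
  set F : ℝ → ℝ := fun y => Real.sqrt (1 - (q y ^ 2)⁻¹) with hF
  have hrad : ∀ y, a < y → 0 < 1 - (q y ^ 2)⁻¹ := fun y hy =>
    sub_pos.mpr (inv_lt_one_of_one_lt₀ (one_lt_pow₀ (hq1 y hy) two_ne_zero))
  have hF0 : ∀ y, a < y → 0 < F y := fun y hy => Real.sqrt_pos.mpr (hrad y hy)
  have hF1 : ∀ y, a < y → F y < 1 := fun y hy => by
    have : 0 < (q y ^ 2)⁻¹ := by have := hq1 y hy; positivity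
    simp only [hF]
    rw [Real.sqrt_lt' one_pos]
    linarith
  have hFd : ∀ y, a < y → HasDerivAt F (q' y / q y ^ 3 / F y) y := by
    intro y hy
    have hqy : q y ≠ 0 := (one_pos.trans (hq1 y hy)).ne'
    have h := ((((hqd y hy).fun_pow 2).fun_inv (pow_ne_zero 2 hqy)).const_sub 1).sqrt
      (hrad y hy).ne'
    refine h.congr_deriv ?_
    have := (hF0 y hy).ne'
    simp only [hF] at this ⊢
    field_simp
    simp only [Nat.cast_ofNat, Nat.add_one_sub_one, pow_one]
    ring
  have hFK : ∀ y, a < y → F y ≤ Real.sqrt ((m + 1) / a) * (y - a) := by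
    intro y hy
    refine Real.sqrt_le_iff.mpr ⟨mul_nonneg (Real.sqrt_nonneg _) (by linarith), ?_⟩
    rw [mul_pow, Real.sq_sqrt (by positivity)]
    have h1 := hqle y hy
    have h2 := hq1 y hy
    have h3 : 1 - (q y ^ 2)⁻¹ ≤ 2 * (q y - 1) := by
      have h5 : (1 - (q y ^ 2)⁻¹) = (q y ^ 2 - 1) / q y ^ 2 := by field_simp
      rw [h5, div_le_iff₀ (by positivity)]
      nlinarith [mul_pos (sub_pos.mpr h2) (sub_pos.mpr h2),
        mul_nonneg (sub_pos.mpr h2).le (sq_nonneg (q y))]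
    have h4 : (m + 1) / a * (y - a) ^ 2 = 2 * ((m + 1) / (2 * a) * (y - a) ^ 2) := by
      field_simp
    linarith
  have hFh : ∀ y, 1 < y → Real.sqrt (y ^ 2 - 1) / y < F y := by
    intro y hy
    have hy0 : 0 < y := one_pos.trans hy
    have h1 : Real.sqrt (y ^ 2 - 1) / y = Real.sqrt (1 - (y ^ 2)⁻¹) := by
      rw [← Real.sqrt_sq hy0.le, ← Real.sqrt_div' _ (by positivity), Real.sqrt_sq hy0.le]
      congr 1; field_simp
    have h2 : y < q y := by
      simp only [hq]
      linarith [show 0 < a ^ m / (m + 1) * (y ^ m)⁻¹ by positivity]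
    rw [h1]
    apply Real.sqrt_lt_sqrt
    · exact sub_nonneg.mpr (inv_le_one_of_one_le₀ (one_le_pow₀ hy.le))
    · gcongr
  obtain ⟨T, hT, hTbot, hTtop, hTlt, hTgt⟩ := exists_timeMap ha1
    (K := Real.sqrt ((m + 1) / a)) (by positivity) (fun y hy => (hFd y hy).continuousAt)
    hF0 hF1 hFK hFh
  obtain ⟨f, hfa, hTf, hfd, hfbot⟩ := exists_solution_of_timeMap hF0 hT hTbot hTtop
  have hfc : Continuous f := continuous_iff_continuousAt.mpr fun t => (hfd t).continuousAt
  have hf0 : ∀ t, f t ≠ 0 := fun t => (ha0.trans (hfa t)).ne'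
  have hqf0 : ∀ t, q (f t) ≠ 0 := fun t => (one_pos.trans (hq1 _ (hfa t))).ne'
  refine ⟨f, fun t => F (f t), fun t => q' (f t) / q (f t) ^ 3, hfd, fun t => ?_, ?_, fun t => ?_,
    fun t => ⟨hfa t, ?_, ?_⟩, hfbot, fun t => ?_⟩
  · refine ((hFd _ (hfa t)).comp t (hfd t)).congr_deriv ?_
    have := (hF0 _ (hfa t)).ne'
    field_simp
  · have hqfc : Continuous fun t => q (f t) := by
      rw [← continuousOn_univ]
      exact hqc.comp hfc.continuousOn fun t _ => (hfa t).le
    refine Continuous.div ?_ (hqfc.pow 3) fun t => pow_ne_zero 3 (hqf0 t)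
    simp only [hq']
    fun_prop (disch := exact hf0)
  · refine ⟨hF0 _ (hfa t), hF1 _ (hfa t), div_pos (hq'pos _ (hfa t)) ?_⟩
    exact pow_pos (one_pos.trans (hq1 _ (hfa t))) 3
  · have := hTlt _ (hfa t)
    rwa [hTf] at this
  · apply Real.lt_sqrt_of_sq_lt
    rcases lt_or_ge (f t) 1 with h | h
    · have := ha0.trans (hfa t)
      nlinarith
    · have h1 := hTgt _ h
      rw [hTf, Real.sqrt_lt' ((Real.sqrt_nonneg _).trans_lt h1)] at h1
      linarith
  · have hs : Real.sqrt (1 - F (f t) ^ 2) = (q (f t))⁻¹ := by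
      rw [show F (f t) ^ 2 = 1 - (q (f t) ^ 2)⁻¹ from Real.sq_sqrt (hrad _ (hfa t)).le,
        sub_sub_cancel, ← inv_pow, Real.sqrt_sq (inv_nonneg.mpr (one_pos.trans (hq1 _ (hfa t))).le)]
    rw [hs]
    have h1 : q' (f t) / q (f t) ^ 3 / (q (f t))⁻¹ ^ 3 + m / (f t * (q (f t))⁻¹) =
        q' (f t) + m * q (f t) / f t := by
      have := hqf0 t
      have := hf0 t
      field_simp
    rw [h1]
    simp only [hq, hq', div_pow, hapow]
    have := hf0 t
    field_simp
    ring

end Profile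

section Barriers

variable {n : ℕ} [NeZero n]

lemma sqrt_radSq_le_invGraph (g : ℝ → ℝ) (x : EuclideanSpace ℝ (Fin n)) :
    Real.sqrt (radSq x) ≤ invGraph g x :=
  Real.sqrt_le_sqrt (by linarith [sq_nonneg (g (x 0))])

lemma le_invGraph (g : ℝ → ℝ) (x : EuclideanSpace ℝ (Fin n)) : g (x 0) ≤ invGraph g x :=
  Real.le_sqrt_of_sq_le (by linarith [radSq_nonneg x])

lemma norm_eq_invGraph (x : EuclideanSpace ℝ (Fin n)) : ‖x‖ = invGraph (fun t => t) x := by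
  rw [invGraph, ← norm_sq_eq_add_radSq, Real.sqrt_sq (norm_nonneg x)]

lemma invGraph_le_invGraph {g h : ℝ → ℝ} {x : EuclideanSpace ℝ (Fin n)} (h0 : 0 ≤ g (x 0))
    (hgh : g (x 0) ≤ h (x 0)) : invGraph g x ≤ invGraph h x := by
  unfold invGraph
  gcongr

lemma norm_le_abs_add_sqrt_radSq (x : EuclideanSpace ℝ (Fin n)) :
    ‖x‖ ≤ |x 0| + Real.sqrt (radSq x) := by
  rw [← Real.sqrt_sq (norm_nonneg x), norm_sq_eq_add_radSq]
  apply Real.sqrt_le_iff.mpr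
  refine ⟨by positivity, ?_⟩
  nlinarith [Real.sq_sqrt (radSq_nonneg x), sq_abs (x 0),
    mul_nonneg (abs_nonneg (x 0)) (Real.sqrt_nonneg (radSq x))]

lemma sub_invGraph_le_of_large_norm {u : EuclideanSpace ℝ (Fin n) → ℝ}
    (hC : ∀ ε > (0 : ℝ), ∃ R : ℝ, ∀ x : EuclideanSpace ℝ (Fin n), x 0 ≤ 0 →
      R ≤ Real.sqrt (radSq x) → u x ≤ Real.sqrt (radSq x) + ε)
    (hD : ∀ ε > (0 : ℝ), ∃ R : ℝ, ∀ x : EuclideanSpace ℝ (Fin n), R ≤ ‖x‖ → 0 ≤ x 0 →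
      u x ≤ ‖x‖ + ε)
    {g : ℝ → ℝ} (hg : ∀ t, 0 ≤ t → t ≤ g t)
    (htube : ∀ R : ℝ, ∃ T : ℝ, ∀ x : EuclideanSpace ℝ (Fin n), x 0 ≤ -T →
      Real.sqrt (radSq x) ≤ R → u x ≤ invGraph g x) {ε : ℝ} (hε : 0 < ε) :
    ∃ R : ℝ, ∀ x : EuclideanSpace ℝ (Fin n), R ≤ ‖x‖ → u x - invGraph g x ≤ ε := by
  obtain ⟨R₁, hR₁⟩ := hC ε hε
  obtain ⟨R₂, hR₂⟩ := hD ε hε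
  obtain ⟨T, hT⟩ := htube R₁
  refine ⟨max R₂ (|T| + |R₁|), fun x hx => ?_⟩
  obtain ⟨hx1, hx2⟩ := max_le_iff.mp hx
  rcases le_or_gt 0 (x 0) with h0 | h0
  · have h1 := hR₂ x hx1 h0
    have h2 : ‖x‖ ≤ invGraph g x := by
      rw [norm_eq_invGraph]
      exact invGraph_le_invGraph h0 (hg _ h0)
    linarith
  · rcases le_or_gt R₁ (Real.sqrt (radSq x)) with h1 | h1
    · linarith [hR₁ x h0.le h1, sqrt_radSq_le_invGraph g x]
    · have h2 := norm_le_abs_add_sqrt_radSq x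
      rw [abs_of_neg h0] at h2
      linarith [hT x (by linarith [le_abs_self T, le_abs_self R₁]) h1.le]

lemma invGraph_sub_le_of_large_norm {u : EuclideanSpace ℝ (Fin n) → ℝ}
    (hA : ∀ x, Real.sqrt (radSq x) ≤ u x) (hB : ∀ x, 0 ≤ x 0 → ‖x‖ ≤ u x)
    {g : ℝ → ℝ} (hgc : Continuous g) (hg0 : ∀ t, 0 ≤ g t)
    (hleft : ∃ T : ℝ, ∀ x : EuclideanSpace ℝ (Fin n), x 0 ≤ -T → invGraph g x ≤ u x)
    (hright : ∀ ε > (0 : ℝ), ∃ T : ℝ, ∀ t, T ≤ t → g t ≤ t + ε) {ε : ℝ} (hε : 0 < ε) :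
    ∃ R : ℝ, ∀ x : EuclideanSpace ℝ (Fin n), R ≤ ‖x‖ → invGraph g x - u x ≤ ε := by
  obtain ⟨T₁, hT₁⟩ := hleft
  obtain ⟨T₂, hT₂⟩ := hright ε hε
  obtain ⟨M, hM⟩ := (isCompact_Icc (a := -|T₁|) (b := |T₂|)).bddAbove_image hgc.continuousOn
  refine ⟨|T₁| + |T₂| + (M ^ 2 / (2 * ε) + 1), fun x hx => ?_⟩
  rcases le_or_gt (x 0) (-|T₁|) with h1 | h1
  · linarith [hT₁ x (by linarith [le_abs_self T₁])]
  rcases le_or_gt |T₂| (x 0) with h2 | h2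
  · have h0 : 0 ≤ x 0 := (abs_nonneg _).trans h2
    have h3 := hT₂ (x 0) ((le_abs_self _).trans h2)
    have h4 : invGraph g x ≤ ‖x‖ + ε := by
      refine Real.sqrt_le_iff.mpr ⟨by positivity, ?_⟩
      have h5 : x 0 ≤ ‖x‖ := by rw [norm_eq_invGraph]; exact le_invGraph (fun t => t) x
      have h6 := hg0 (x 0)
      nlinarith [norm_sq_eq_add_radSq x]
    linarith [hB x h0]
  · have h3 : g (x 0) ≤ M := hM ⟨x 0, ⟨h1.le, h2.le⟩, rfl⟩
    have h4 := norm_le_abs_add_sqrt_radSq x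
    have h5 : |x 0| ≤ |T₁| + |T₂| :=
      abs_le.mpr ⟨by linarith [abs_nonneg T₂], by linarith [abs_nonneg T₁]⟩
    have h6 : M ^ 2 / (2 * ε) < Real.sqrt (radSq x) := by linarith
    have h7 : 0 < Real.sqrt (radSq x) := lt_of_le_of_lt (by positivity) h6
    have h8 : invGraph g x ≤ Real.sqrt (radSq x) + g (x 0) ^ 2 / (2 * Real.sqrt (radSq x)) := by
      have := sqrt_sq_add_le h7 (sq_nonneg (g (x 0)))
      rwa [Real.sq_sqrt (radSq_nonneg x), add_comm (radSq x)] at this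
    have h9 : g (x 0) ^ 2 / (2 * Real.sqrt (radSq x)) ≤ ε := by
      rw [div_lt_iff₀ (by positivity)] at h6
      rw [div_le_iff₀ (by positivity)]
      nlinarith [hg0 (x 0)]
    linarith [hA x]

/-- The first two derivatives of the hyperbola `g² = A² + κ²(t - m)²`. -/
lemma hasDerivAt_hyperbola {A κ m : ℝ} (hA : 0 < A) (t : ℝ) :
    HasDerivAt (fun t => Real.sqrt (A ^ 2 + κ ^ 2 * (t - m) ^ 2))
      (κ ^ 2 * (t - m) / Real.sqrt (A ^ 2 + κ ^ 2 * (t - m) ^ 2)) t ∧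
    HasDerivAt (fun t => κ ^ 2 * (t - m) / Real.sqrt (A ^ 2 + κ ^ 2 * (t - m) ^ 2))
      (κ ^ 2 * A ^ 2 / Real.sqrt (A ^ 2 + κ ^ 2 * (t - m) ^ 2) ^ 3) t := by
  have hpos : 0 < A ^ 2 + κ ^ 2 * (t - m) ^ 2 := by positivity
  have hs := (Real.sqrt_pos.mpr hpos).ne'
  have hs2 := Real.sq_sqrt hpos.le
  have h1 : HasDerivAt (fun t => Real.sqrt (A ^ 2 + κ ^ 2 * (t - m) ^ 2))
      (κ ^ 2 * (t - m) / Real.sqrt (A ^ 2 + κ ^ 2 * (t - m) ^ 2)) t := by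
    refine ((((((hasDerivAt_id' t).sub_const m).fun_pow 2).const_mul (κ ^ 2)).const_add
      (A ^ 2)).sqrt hpos.ne').congr_deriv ?_
    simp
    field_simp
  refine ⟨h1, ((((hasDerivAt_id' t).sub_const m).const_mul (κ ^ 2)).fun_div h1 hs).congr_deriv ?_⟩
  set S := Real.sqrt (A ^ 2 + κ ^ 2 * (t - m) ^ 2)
  field_simp
  rw [hs2]
  ring

lemma le_invGraph_hyperboloid {u : EuclideanSpace ℝ (Fin n) → ℝ} (hsm : ContDiff ℝ (⊤ : ℕ∞) u)
    (hsp : ∀ x, ‖gradient u x‖ < 1)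
    (hmc : ∀ x, divg n (fun z => (Real.sqrt (1 - ‖gradient u z‖ ^ 2))⁻¹ • gradient u z) x = n)
    (hC : ∀ ε > (0 : ℝ), ∃ R : ℝ, ∀ x : EuclideanSpace ℝ (Fin n), x 0 ≤ 0 →
      R ≤ Real.sqrt (radSq x) → u x ≤ Real.sqrt (radSq x) + ε)
    (hD : ∀ ε > (0 : ℝ), ∃ R : ℝ, ∀ x : EuclideanSpace ℝ (Fin n), R ≤ ‖x‖ → 0 ≤ x 0 →
      u x ≤ ‖x‖ + ε) {C : ℝ} (hE : ∀ x, x 0 < 0 → u x ≤ Real.sqrt (radSq x) + C)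
    (x : EuclideanSpace ℝ (Fin n)) :
    u x ≤ invGraph (fun t => Real.sqrt (2 ^ 2 + 1 ^ 2 * (t - 0) ^ 2)) x := by
  have hn : (0 : ℝ) < n := Nat.cast_pos.mpr (NeZero.pos n)
  have hpos : ∀ t : ℝ, 0 < (2:ℝ) ^ 2 + 1 ^ 2 * (t - 0) ^ 2 := fun t => by positivity
  have habs : ∀ t : ℝ, |t| ≤ Real.sqrt (2 ^ 2 + 1 ^ 2 * (t - 0) ^ 2) := fun t =>
    Real.abs_le_sqrt (by linarith)
  have := comparison_invGraph hsm hsp hmc one_ne_zero isOpen_univ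
    (g := fun t => Real.sqrt (2 ^ 2 + 1 ^ 2 * (t - 0) ^ 2)) (by fun_prop)
    (fun t _ => Real.sqrt_pos.mpr (hpos t)) (fun t _ => (hasDerivAt_hyperbola two_pos t).1)
    (fun t _ => (hasDerivAt_hyperbola two_pos t).2) (fun t _ => ?_) (fun _ h => (h trivial).elim)
    (fun ε hε => ?_) x
  · linarith
  · have hS := Real.sqrt_pos.mpr (hpos t)
    have hS2 := Real.sq_sqrt (hpos t).le
    set S := Real.sqrt (2 ^ 2 + 1 ^ 2 * (t - 0) ^ 2)
    have h1 : Real.sqrt (1 - (1 ^ 2 * (t - 0) / S) ^ 2) = 2 / S := by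
      rw [← Real.sqrt_sq (show 0 ≤ 2 / S by positivity)]
      congr 1
      field_simp
      rw [hS2]; ring
    rw [h1]
    field_simp
    linarith
  · obtain ⟨R, hR⟩ := sub_invGraph_le_of_large_norm hC hD
      (g := fun t => Real.sqrt (2 ^ 2 + 1 ^ 2 * (t - 0) ^ 2))
      (fun t _ => (le_abs_self t).trans (habs t)) (fun R => ⟨|R + C| + 1, fun y hy hyR => by
        have h1 := hE y (by linarith [abs_nonneg (R + C)])
        have h2 := le_invGraph (fun t => Real.sqrt (2 ^ 2 + 1 ^ 2 * (t - 0) ^ 2)) y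
        have h3 := habs (y 0)
        linarith [neg_abs_le (y 0), le_abs_self (R + C)]⟩) hε
    exact ⟨R, fun y _ hy => by rw [one_mul]; exact hR y hy⟩

/-- Far to the left, a solution lies below every slightly enlarged trough. -/
lemma le_trough_of_left {u : EuclideanSpace ℝ (Fin n) → ℝ} (hsm : ContDiff ℝ (⊤ : ℕ∞) u)
    (hsp : ∀ x, ‖gradient u x‖ < 1)
    (hmc : ∀ x, divg n (fun z => (Real.sqrt (1 - ‖gradient u z‖ ^ 2))⁻¹ • gradient u z) x = n)
    (hC : ∀ ε > (0 : ℝ), ∃ R : ℝ, ∀ x : EuclideanSpace ℝ (Fin n), x 0 ≤ 0 →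
      R ≤ Real.sqrt (radSq x) → u x ≤ Real.sqrt (radSq x) + ε)
    (hD : ∀ ε > (0 : ℝ), ∃ R : ℝ, ∀ x : EuclideanSpace ℝ (Fin n), R ≤ ‖x‖ → 0 ≤ x 0 →
      u x ≤ ‖x‖ + ε) {C : ℝ} (hE : ∀ x, x 0 < 0 → u x ≤ Real.sqrt (radSq x) + C)
    {A : ℝ} (hA0 : 0 < A) (hA : ((n : ℝ) - 1) / n < A) :
    ∃ T : ℝ, ∀ x : EuclideanSpace ℝ (Fin n), x 0 ≤ -T → u x ≤ invGraph (fun _ => A) x := by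
  have hn : (0 : ℝ) < n := Nat.cast_pos.mpr (NeZero.pos n)
  have hn1 : (0 : ℝ) ≤ n - 1 := by
    have : (1 : ℝ) ≤ n := by exact_mod_cast NeZero.one_le
    linarith
  obtain ⟨κ, hκ0, hκ1, hκ⟩ : ∃ κ : ℝ, 0 < κ ∧ κ < 1 ∧
      κ ^ 2 / A / Real.sqrt (1 - κ ^ 2) ^ 3 + ((n : ℝ) - 1) / (A * Real.sqrt (1 - κ ^ 2)) < n := by
    have hc : ContinuousAt (fun κ : ℝ => κ ^ 2 / A / Real.sqrt (1 - κ ^ 2) ^ 3 +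
        ((n : ℝ) - 1) / (A * Real.sqrt (1 - κ ^ 2))) 0 := by
      fun_prop (disch := simp [hA0.ne'])
    have h0 : (fun κ : ℝ => κ ^ 2 / A / Real.sqrt (1 - κ ^ 2) ^ 3 +
        ((n : ℝ) - 1) / (A * Real.sqrt (1 - κ ^ 2))) (0 : ℝ) < (n : ℝ) := by
      simp only [ne_eq, OfNat.ofNat_ne_zero, not_false_eq_true, zero_pow, sub_zero, Real.sqrt_one,
        mul_one, zero_div, zero_add]
      rw [div_lt_iff₀ hn] at hA
      rw [div_lt_iff₀ hA0]
      linarith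
    obtain ⟨κ, ⟨h1, h2⟩, h3⟩ := ((((hc.eventually_lt_const h0).filter_mono
      nhdsWithin_le_nhds).and ((eventually_lt_nhds (one_pos (α := ℝ))).filter_mono
      nhdsWithin_le_nhds)).and (self_mem_nhdsWithin (s := Set.Ioi (0:ℝ)))).exists
    exact ⟨κ, h3, h2, h1⟩
  refine ⟨2 / κ, fun x hx => ?_⟩
  set m := x 0 with hm
  set G : ℝ → ℝ := fun t => Real.sqrt (A ^ 2 + κ ^ 2 * (t - m) ^ 2) with hG
  have hpos : ∀ t : ℝ, 0 < A ^ 2 + κ ^ 2 * (t - m) ^ 2 := fun t => by positivity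
  have hGabs : ∀ t, κ * |t - m| ≤ G t := fun t => by
    refine Real.le_sqrt_of_sq_le ?_
    rw [mul_pow, sq_abs]
    linarith [sq_nonneg A]
  have hGA : ∀ t, A ≤ G t := fun t =>
    Real.le_sqrt_of_sq_le (by linarith [show 0 ≤ κ ^ 2 * (t - m) ^ 2 by positivity])
  have hG0 : 2 ≤ G 0 := by
    refine le_trans ?_ (hGabs 0)
    rw [zero_sub, abs_neg]
    have : 2 / κ ≤ |m| := by linarith [neg_abs_le m]
    rwa [div_le_iff₀ hκ0, mul_comm] at this
  have heq : ∀ t ∈ Set.Iio (0 : ℝ), (fun t => G (min t 0) + max t 0) =ᶠ[nhds t] G := fun t ht => by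
    filter_upwards [Iio_mem_nhds ht] with s hs
    rw [min_eq_left (le_of_lt hs), max_eq_right (le_of_lt hs), add_zero]
  have heq' : ∀ t ∈ Set.Iio (0 : ℝ), G (min t 0) + max t 0 = G t := fun t ht =>
    (heq t ht).self_of_nhds
  have hGc : Continuous G := by fun_prop
  have := comparison_invGraph hsm hsp hmc one_ne_zero (isOpen_Iio (a := (0:ℝ)))
    (g := fun t => G (min t 0) + max t 0) (by fun_prop)
    (fun t ht => by rw [heq' t ht]; exact hA0.trans_le (hGA t))
    (fun t ht => (hasDerivAt_hyperbola hA0 t).1.congr_of_eventuallyEq (heq t ht))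
    (fun t _ => (hasDerivAt_hyperbola hA0 t).2) (fun t ht => ?_) (fun y hy => ?_)
    (fun ε hε => ?_) x
  · have h0 : 2 / κ > 0 := by positivity
    have h1 : invGraph (fun t => G (min t 0) + max t 0) x = invGraph (fun _ => A) x := by
      have h2 := heq' m (show m < 0 by linarith)
      simp only [invGraph, ← hm, h2]
      simp [hG, Real.sqrt_sq hA0.le]
    rw [h1] at this
    linarith
  · rw [heq' t ht, one_mul, one_mul]
    refine lt_of_le_of_lt ?_ hκ
    have hS := Real.sqrt_pos.mpr (hpos t)
    have hS2 := Real.sq_sqrt (hpos t).le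
    have hSA : A ≤ Real.sqrt (A ^ 2 + κ ^ 2 * (t - m) ^ 2) := hGA t
    simp only [hG]
    set S := Real.sqrt (A ^ 2 + κ ^ 2 * (t - m) ^ 2)
    have hw : 0 < Real.sqrt (1 - κ ^ 2) := Real.sqrt_pos.mpr (by nlinarith)
    have hws : Real.sqrt (1 - κ ^ 2) ≤ Real.sqrt (1 - (κ ^ 2 * (t - m) / S) ^ 2) := by
      apply Real.sqrt_le_sqrt
      have : (κ ^ 2 * (t - m) / S) ^ 2 ≤ κ ^ 2 := by
        rw [div_pow, div_le_iff₀ (by positivity), hS2]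
        have : 0 ≤ κ ^ 2 * A ^ 2 := by positivity
        nlinarith
      linarith
    have hg2 : κ ^ 2 * A ^ 2 / S ^ 3 ≤ κ ^ 2 / A := by
      rw [div_le_div_iff₀ (by positivity) hA0]
      have : A ^ 3 ≤ S ^ 3 := by gcongr
      nlinarith [sq_nonneg κ]
    gcongr
  · have hy0 : 0 ≤ y 0 := by simpa using hy
    have h1 := le_invGraph_hyperboloid hsm hsp hmc hC hD hE y
    have h2 : invGraph (fun t => Real.sqrt (2 ^ 2 + 1 ^ 2 * (t - 0) ^ 2)) y ≤
        invGraph (fun t => G (min t 0) + max t 0) y := by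
      refine invGraph_le_invGraph (g := fun t => Real.sqrt (2 ^ 2 + 1 ^ 2 * (t - 0) ^ 2))
        (h := fun t => G (min t 0) + max t 0) (Real.sqrt_nonneg _) ?_
      simp only [min_eq_right hy0, max_eq_left hy0]
      refine Real.sqrt_le_iff.mpr ⟨by linarith, ?_⟩
      nlinarith
    linarith
  · obtain ⟨R, hR⟩ := sub_invGraph_le_of_large_norm hC hD
      (g := fun t => G (min t 0) + max t 0)
      (fun t ht => by
        rw [min_eq_right ht, max_eq_left ht]; linarith)
      (fun R => ⟨|R + C| / κ + |m| + 1, fun y hy hyR => by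
        have h0 : 0 ≤ |R + C| / κ := by positivity
        have hy0 : y 0 < 0 := by linarith [abs_nonneg m]
        have h1 := hE y hy0
        have h2 := le_invGraph (fun t => G (min t 0) + max t 0) y
        have h3 := hGabs (y 0)
        rw [heq' _ hy0] at h2
        have h4 : |R + C| / κ ≤ |y 0 - m| := by linarith [neg_abs_le (y 0 - m), neg_abs_le m]
        rw [div_le_iff₀ hκ0] at h4
        linarith [le_abs_self (R + C)]⟩) hε
    exact ⟨R, fun y _ hy => by rw [one_mul]; exact hR y hy⟩

/-- A solution lies above every slightly shrunk trough. -/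
lemma trough_le {u : EuclideanSpace ℝ (Fin n) → ℝ} (hsm : ContDiff ℝ (⊤ : ℕ∞) u)
    (hsp : ∀ x, ‖gradient u x‖ < 1)
    (hmc : ∀ x, divg n (fun z => (Real.sqrt (1 - ‖gradient u z‖ ^ 2))⁻¹ • gradient u z) x = n)
    (hA : ∀ x, Real.sqrt (radSq x) ≤ u x) (hB : ∀ x, 0 ≤ x 0 → ‖x‖ ≤ u x)
    {A : ℝ} (hA0 : 0 < A) (hA1 : A < ((n : ℝ) - 1) / n) (x : EuclideanSpace ℝ (Fin n)) :
    invGraph (fun _ => A) x ≤ u x := by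
  have hn : (0 : ℝ) < n := Nat.cast_pos.mpr (NeZero.pos n)
  have hn1 : (0 : ℝ) ≤ n - 1 := by
    have : (1 : ℝ) ≤ n := by exact_mod_cast NeZero.one_le
    linarith
  obtain ⟨k, hk0, hk1, hk⟩ : ∃ k : ℝ, 0 < k ∧ 4 * k * A < 1 ∧
      (n : ℝ) < -(2 * k / Real.sqrt (1 - 4 * k * A) ^ 3) + ((n : ℝ) - 1) / A := by
    have hc : ContinuousAt (fun k : ℝ => -(2 * k / Real.sqrt (1 - 4 * k * A) ^ 3) +
        ((n : ℝ) - 1) / A) 0 := by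
      fun_prop (disch := simp)
    have hc' : ContinuousAt (fun k : ℝ => 4 * k * A) 0 := by fun_prop
    have h0 : (n : ℝ) < (fun k : ℝ => -(2 * k / Real.sqrt (1 - 4 * k * A) ^ 3) +
        ((n : ℝ) - 1) / A) 0 := by
      simp only [mul_zero, zero_div, neg_zero, zero_add]
      rw [lt_div_iff₀ hn] at hA1
      rw [lt_div_iff₀ hA0]
      linarith
    have h0' : (fun k : ℝ => 4 * k * A) 0 < 1 := by simp
    obtain ⟨k, ⟨h1, h2⟩, h3⟩ := ((((hc.eventually_const_lt h0).filter_mono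
      nhdsWithin_le_nhds).and ((hc'.eventually_lt_const h0').filter_mono
      nhdsWithin_le_nhds)).and (self_mem_nhdsWithin (s := Set.Ioi (0:ℝ)))).exists
    exact ⟨k, h3, h2, h1⟩
  set m := x 0 with hm
  set G : ℝ → ℝ := fun t => A - k * (t - m) ^ 2 with hG
  have hGc : Continuous G := by fun_prop
  have hIo : IsOpen {t | 0 < G t} := isOpen_lt continuous_const hGc
  have heq : ∀ t ∈ {t | 0 < G t}, (fun t => max (G t) 0) =ᶠ[nhds t] G := fun t ht => by
    filter_upwards [hIo.mem_nhds ht] with s hs using max_eq_left (le_of_lt hs)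
  have heq' : ∀ t ∈ {t | 0 < G t}, max (G t) 0 = G t := fun t ht => (heq t ht).self_of_nhds
  have hzero : ∀ y : EuclideanSpace ℝ (Fin n), G (y 0) ≤ 0 →
      invGraph (fun t => max (G t) 0) y = Real.sqrt (radSq y) := fun y hy => by
    simp [invGraph, max_eq_right hy]
  have hneg : ∀ t, A / k + 1 ≤ |t - m| → G t ≤ 0 := fun t ht => by
    have h1 : A / k + 1 ≤ (t - m) ^ 2 := by
      have : 0 < A / k := by positivity
      rw [← sq_abs]
      nlinarith
    have h2 : k * (A / k + 1) ≤ k * (t - m) ^ 2 := by gcongr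
    have h3 : k * (A / k + 1) = A + k := by field_simp
    simp only [hG]
    linarith
  have := comparison_invGraph hsm hsp hmc (neg_ne_zero.mpr one_ne_zero) hIo
    (g := fun t => max (G t) 0) (g₁ := fun t => -(k * (2 * (t - m)))) (g₂ := fun _ => -(2 * k))
    (by fun_prop)
    (fun t ht => by rw [heq' t ht]; exact ht)
    (fun t ht => HasDerivAt.congr_of_eventuallyEq (by
      refine (((((hasDerivAt_id' t).sub_const m).fun_pow 2).const_mul k).const_sub A).congr_deriv ?_
      simp) (heq t ht))
    (fun t _ => by
      refine ((((hasDerivAt_id' t).sub_const m).const_mul 2).const_mul k).fun_neg.congr_deriv ?_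
      ring) (fun t ht => ?_) (fun y hy => ?_)
    (fun ε hε => ?_) x
  · have h1 : invGraph (fun t => max (G t) 0) x = invGraph (fun _ => A) x := by
      unfold invGraph
      simp [hG, ← hm, hA0.le]
    rw [h1] at this
    linarith
  · rw [heq' t ht, neg_one_mul, neg_one_mul, neg_lt_neg_iff]
    refine lt_of_lt_of_le hk ?_
    have htpos : 0 < G t := ht
    have hGA : G t ≤ A := by
      simp only [hG]; linarith [show 0 ≤ k * (t - m) ^ 2 by positivity]
    have hw : 0 < Real.sqrt (1 - 4 * k * A) := Real.sqrt_pos.mpr (by linarith)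
    have hws : Real.sqrt (1 - 4 * k * A) ≤ Real.sqrt (1 - (-(k * (2 * (t - m)))) ^ 2) := by
      apply Real.sqrt_le_sqrt
      have : (-(k * (2 * (t - m)))) ^ 2 = 4 * k * (k * (t - m) ^ 2) := by ring
      rw [this]
      simp only [hG] at htpos
      have : 4 * k * (k * (t - m) ^ 2) ≤ 4 * k * A := by gcongr; linarith
      linarith
    have hs1 : Real.sqrt (1 - (-(k * (2 * (t - m)))) ^ 2) ≤ 1 :=
      Real.sqrt_le_one.mpr (by linarith [sq_nonneg (-(k * (2 * (t - m))))])
    have hs0 := hw.trans_le hws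
    rw [neg_div]
    have h1 : G t * Real.sqrt (1 - (-(k * (2 * (t - m)))) ^ 2) ≤ A := by
      nlinarith
    gcongr
  · rw [hzero y (not_lt.mp hy)]
    linarith [hA y]
  · obtain ⟨R, hR⟩ := invGraph_sub_le_of_large_norm hA hB (g := fun t => max (G t) 0)
      (by fun_prop) (fun t => le_max_right _ _)
      ⟨A / k + 1 + |m|, fun y hy => by
        rw [hzero y (hneg _ (by linarith [neg_abs_le (y 0 - m), neg_abs_le m]))]
        exact hA y⟩
      (fun δ hδ => ⟨A / k + 1 + |m|, fun t ht => by
        have : 0 ≤ A / k := by positivity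
        rw [max_eq_right (hneg _ (by linarith [le_abs_self (t - m), le_abs_self m]))]
        linarith [abs_nonneg m]⟩) hε
    exact ⟨R, fun y _ hy => by linarith [hR y hy]⟩

end Barriers

section Uniqueness

lemma profile_rescale {n : ℕ} {f f₁ f₂ : ℝ → ℝ} (hf : ∀ t, HasDerivAt f (f₁ t) t)
    (hf₁ : ∀ t, HasDerivAt f₁ (f₂ t) t)
    (hode : ∀ t, f₂ t / Real.sqrt (1 - f₁ t ^ 2) ^ 3 +
      ((n : ℝ) - 1) / (f t * Real.sqrt (1 - f₁ t ^ 2)) = n) {l : ℝ} (hl : l ≠ 0) (t : ℝ) :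
    HasDerivAt (fun t => l * f (t / l)) (f₁ (t / l)) t ∧
    HasDerivAt (fun t => f₁ (t / l)) (f₂ (t / l) / l) t ∧
    f₂ (t / l) / l / Real.sqrt (1 - f₁ (t / l) ^ 2) ^ 3 +
      ((n : ℝ) - 1) / (l * f (t / l) * Real.sqrt (1 - f₁ (t / l) ^ 2)) = n / l := by
  have hd : HasDerivAt (fun t : ℝ => t / l) (1 / l) t := (hasDerivAt_id' t).div_const l
  refine ⟨(((hf (t / l)).comp t hd).const_mul l).congr_deriv ?_,
    ((hf₁ (t / l)).comp t hd).congr_deriv ?_, ?_⟩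
  · field_simp
  · field_simp
  · nth_rw 2 [← hode (t / l)]
    rw [add_div, div_right_comm, mul_assoc, mul_comm l, div_div _ _ l, div_div _ _ l]

variable {n : ℕ} [NeZero n]

lemma eq_invGraph_of_rescaled_barriers {f : ℝ → ℝ} (hf : Continuous f)
    {x : EuclideanSpace ℝ (Fin n)} {v : ℝ}
    (hup : ∀ l : ℝ, 1 < l → v ≤ invGraph (fun t => l * f (t / l)) x)
    (hlow : ∀ l : ℝ, 0 < l → l < 1 → invGraph (fun t => l * f (t / l)) x ≤ v) :
    v = invGraph f x := by
  have hc : ContinuousAt (fun l : ℝ => invGraph (fun t => l * f (t / l)) x) 1 := by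
    unfold invGraph
    fun_prop (disch := exact one_ne_zero)
  have h1 : Tendsto (fun l : ℝ => invGraph (fun t => l * f (t / l)) x) (nhds 1)
      (nhds (invGraph f x)) := by simpa [ContinuousAt] using hc
  refine le_antisymm (ge_of_tendsto (h1.mono_left (nhdsWithin_le_nhds (s := Set.Ioi 1))) ?_)
    (le_of_tendsto (h1.mono_left (nhdsWithin_le_nhds (s := Set.Iio 1))) ?_)
  · filter_upwards [self_mem_nhdsWithin] with l hl using hup l hl
  · filter_upwards [self_mem_nhdsWithin, (lt_mem_nhds one_pos).filter_mono nhdsWithin_le_nhds]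
      with l hl hl0 using hlow l hl0 hl

lemma eq_invGraph_of_asymptotic (hn : 2 ≤ n) {u : EuclideanSpace ℝ (Fin n) → ℝ}
    (hsm : ContDiff ℝ (⊤ : ℕ∞) u) (hsp : ∀ x, ‖gradient u x‖ < 1)
    (hmc : ∀ x, divg n (fun z => (Real.sqrt (1 - ‖gradient u z‖ ^ 2))⁻¹ • gradient u z) x = n)
    (hA : ∀ x, Real.sqrt (radSq x) ≤ u x) (hB : ∀ x, 0 ≤ x 0 → ‖x‖ ≤ u x)
    (hC : ∀ ε > (0 : ℝ), ∃ R : ℝ, ∀ x : EuclideanSpace ℝ (Fin n), x 0 ≤ 0 →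
      R ≤ Real.sqrt (radSq x) → u x ≤ Real.sqrt (radSq x) + ε)
    (hD : ∀ ε > (0 : ℝ), ∃ R : ℝ, ∀ x : EuclideanSpace ℝ (Fin n), R ≤ ‖x‖ → 0 ≤ x 0 →
      u x ≤ ‖x‖ + ε) {C : ℝ} (hE : ∀ x, x 0 < 0 → u x ≤ Real.sqrt (radSq x) + C)
    {f f₁ f₂ : ℝ → ℝ} (hf : ∀ t, HasDerivAt f (f₁ t) t) (hf₁ : ∀ t, HasDerivAt f₁ (f₂ t) t)
    (hbd : ∀ t, ((n : ℝ) - 1) / n < f t ∧ t < f t ∧ f t < Real.sqrt (1 + t ^ 2))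
    (hlim : Tendsto f atBot (nhds (((n : ℝ) - 1) / n)))
    (hode : ∀ t, f₂ t / Real.sqrt (1 - f₁ t ^ 2) ^ 3 +
      ((n : ℝ) - 1) / (f t * Real.sqrt (1 - f₁ t ^ 2)) = n)
    (x : EuclideanSpace ℝ (Fin n)) : u x = invGraph f x := by
  have hn0 : (0 : ℝ) < n := Nat.cast_pos.mpr (NeZero.pos n)
  have ha : 0 < ((n : ℝ) - 1) / n := by
    have : (2 : ℝ) ≤ n := by exact_mod_cast hn
    exact div_pos (by linarith) hn0
  have hfc : Continuous f := continuous_iff_continuousAt.mpr fun t => (hf t).continuousAt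
  have hpos : ∀ t, 0 < f t := fun t => ha.trans (hbd t).1
  have hfar : ∀ σ : ℝ, ∀ l : ℝ, 0 < l → σ * ((n : ℝ) / l) < σ * n → σ ≠ 0 →
      (∀ ε > (0 : ℝ), ∃ R : ℝ, ∀ y : EuclideanSpace ℝ (Fin n), R ≤ ‖y‖ →
        σ * (u y - invGraph (fun t => l * f (t / l)) y) ≤ ε) →
      σ * (u x - invGraph (fun t => l * f (t / l)) x) ≤ 0 := fun σ l hl h hσ hfar =>
    comparison_invGraph hsm hsp hmc hσ isOpen_univ
      (g := fun t => l * f (t / l)) (by fun_prop) (fun t _ => mul_pos hl (hpos _))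
      (fun t _ => (profile_rescale hf hf₁ hode hl.ne' t).1)
      (fun t _ => (profile_rescale hf hf₁ hode hl.ne' t).2.1)
      (fun t _ => by rw [(profile_rescale hf hf₁ hode hl.ne' t).2.2]; exact h)
      (fun _ h => (h trivial).elim)
      (fun ε hε => (hfar ε hε).imp fun R hR y _ hy => hR y hy) x
  refine eq_invGraph_of_rescaled_barriers hfc (fun l hl => ?_) (fun l hl0 hl => ?_)
  · have hl0 : 0 < l := by linarith
    have := hfar 1 l hl0 (by rw [one_mul, one_mul]; exact div_lt_self hn0 hl) one_ne_zero
      (fun ε hε => ?_)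
    · linarith
    obtain ⟨T, hT⟩ := le_trough_of_left hsm hsp hmc hC hD hE (A := l * (((n : ℝ) - 1) / n))
      (by positivity) (by nlinarith)
    obtain ⟨R, hR⟩ := sub_invGraph_le_of_large_norm hC hD (g := fun t => l * f (t / l))
      (fun t _ => by
        have := (hbd (t / l)).2.1
        rw [div_lt_iff₀ hl0] at this
        linarith)
      (fun _ => ⟨T, fun y hy _ => (hT y hy).trans (invGraph_le_invGraph (by positivity)
        (by have := (hbd (y 0 / l)).1; gcongr))⟩) hε
    exact ⟨R, fun y hy => by linarith [hR y hy]⟩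
  · have := hfar (-1) l hl0 (by
      have := (lt_div_iff₀ hl0).mpr (mul_lt_of_lt_one_right hn0 hl)
      linarith) (by norm_num) (fun ε hε => ?_)
    · linarith
    obtain ⟨A, hA1, hA2⟩ := exists_between (mul_lt_of_lt_one_left ha hl)
    have hlim' : Tendsto (fun t => l * f (t / l)) atBot (nhds (l * (((n : ℝ) - 1) / n))) :=
      (hlim.comp (tendsto_id.atBot_div_const hl0)).const_mul l
    obtain ⟨S, hS⟩ := eventually_atBot.mp (hlim'.eventually_lt_const hA1)
    obtain ⟨R, hR⟩ := invGraph_sub_le_of_large_norm hA hB (g := fun t => l * f (t / l))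
      (by fun_prop) (fun t => (mul_pos hl0 (hpos _)).le)
      ⟨-S, fun y hy => (invGraph_le_invGraph (g := fun t => l * f (t / l)) (h := fun _ => A)
        (mul_pos hl0 (hpos _)).le (hS (y 0) (by linarith)).le).trans
        (trough_le hsm hsp hmc hA hB ((by positivity : 0 < l * (((n : ℝ) - 1) / n)).trans hA1)
          hA2 y)⟩
      (fun δ hδ => ⟨1 / (2 * δ), fun t ht => by
        have ht0 : 0 < t := lt_of_lt_of_le (by positivity) ht
        rw [div_le_iff₀ (by positivity)] at ht
        have h1 : f (t / l) ≤ (t + δ) / l := by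
          refine (hbd (t / l)).2.2.le.trans (Real.sqrt_le_iff.mpr ⟨by positivity, ?_⟩)
          rw [div_pow, div_pow, ← sub_nonneg]
          have : ((t + δ) ^ 2 / l ^ 2 - (1 + t ^ 2 / l ^ 2)) =
            (2 * t * δ + δ ^ 2 - l ^ 2) / l ^ 2 := by field_simp; ring
          rw [this]
          apply div_nonneg _ (by positivity)
          nlinarith
        rwa [le_div_iff₀' hl0] at h1⟩) hε
    exact ⟨R, fun y hy => by linarith [hR y hy]⟩

end Uniqueness

/-- Uniqueness of the CMC semitrough: an entire smooth spacelike solution of the constant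
mean curvature equation `div(Du/√(1-|Du|²)) = n` with `u - V₊ → 0` in the lightlike
directions of the closed upper hemisphere and in the directions `x₁ → -∞`, `|x̄| → ∞`,
and `|u - V₊|` globally bounded, is the standard semitrough `z¹`. -/
theorem cmc_semitrough_uniqueness (n : ℕ) [NeZero n] (hn : 2 ≤ n)
    (u : EuclideanSpace ℝ (Fin n) → ℝ)
    (hsm : ContDiff ℝ (⊤ : ℕ∞) u)
    (hsp : ∀ x : EuclideanSpace ℝ (Fin n), ‖gradient u x‖ < 1)
    (hmc : ∀ x : EuclideanSpace ℝ (Fin n),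
      divg n (fun z => (Real.sqrt (1 - ‖gradient u z‖ ^ 2))⁻¹ • gradient u z) x = n)
    (hasym : ∀ ε > (0 : ℝ), ∃ R > (0 : ℝ), ∀ x : EuclideanSpace ℝ (Fin n),
      ((R ≤ ‖x‖ ∧ 0 ≤ x 0) → |u x - Vplus n x| < ε) ∧
      ((x 0 ≤ -R ∧ R ≤ Real.sqrt (∑ i ∈ Finset.univ.erase (0 : Fin n), x i ^ 2)) →
        |u x - Vplus n x| < ε))
    (C₀ : ℝ) (hC₀ : 0 < C₀)
    (hbd : ∀ x : EuclideanSpace ℝ (Fin n), |u x - Vplus n x| ≤ C₀) :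
    ∃ f : ℝ → ℝ, ContDiff ℝ 2 f ∧
      (∀ t : ℝ, 0 < deriv f t ∧ deriv f t < 1 ∧ 0 < deriv (deriv f) t) ∧
      Tendsto f atBot (nhds (((n : ℝ) - 1) / n)) ∧
      (∀ t : ℝ, max (((n : ℝ) - 1) / n) t < f t ∧ f t < Real.sqrt (1 + t ^ 2)) ∧
      (∀ t : ℝ, deriv (deriv f) t / (1 - deriv f t ^ 2) ^ ((3 : ℝ) / 2) +
          ((n : ℝ) - 1) / (f t * (1 - deriv f t ^ 2) ^ ((1 : ℝ) / 2)) = n) ∧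
      ∀ x : EuclideanSpace ℝ (Fin n),
        u x = Real.sqrt (f (x 0) ^ 2 + ∑ i ∈ Finset.univ.erase (0 : Fin n), x i ^ 2) := by
  have hV : ∀ x : EuclideanSpace ℝ (Fin n), 0 ≤ x 0 → Vplus n x = ‖x‖ := fun x hx => if_pos hx
  have hV' : ∀ x : EuclideanSpace ℝ (Fin n), x 0 < 0 → Vplus n x = Real.sqrt (radSq x) :=
    fun x hx => if_neg hx.not_ge
  have hlip := abs_sub_le_norm_of_spacelike hsm hsp
  have h1 : ∀ ε > (0 : ℝ), ∃ R : ℝ, ∀ x : EuclideanSpace ℝ (Fin n), R ≤ ‖x‖ → 0 ≤ x 0 →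
      |u x - ‖x‖| < ε := fun ε hε => by
    obtain ⟨R, _, hR⟩ := hasym ε hε
    exact ⟨R, fun x hx h0 => hV x h0 ▸ (hR x).1 ⟨hx, h0⟩⟩
  have h2 : ∀ ε > (0 : ℝ), ∃ R > (0 : ℝ), ∀ x : EuclideanSpace ℝ (Fin n), x 0 ≤ -R →
      R ≤ Real.sqrt (radSq x) → |u x - Real.sqrt (radSq x)| < ε := fun ε hε => by
    obtain ⟨R, hR0, hR⟩ := hasym ε hε
    exact ⟨R, hR0, fun x hx h0 => hV' x (by linarith) ▸ (hR x).2 ⟨hx, h0⟩⟩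
  obtain ⟨f, f₁, f₂, hf, hf₁, hf₂, hder, hfbd, hlim, hode⟩ := exists_semitrough_profile n hn
  have hdf : deriv f = f₁ := funext fun t => (hf t).deriv
  have hdf₁ : deriv f₁ = f₂ := funext fun t => (hf₁ t).deriv
  have hu := eq_invGraph_of_asymptotic hn hsm hsp hmc
    (sqrt_radSq_le_of_asymptotic hn hlip h1) (fun x hx => norm_le_of_asymptotic hlip h1 hx)
    (fun ε hε => le_sqrt_radSq_add_of_asymptotic hn hlip h1 h2 hε)
    (fun ε hε => (h1 ε hε).imp fun R hR x hx h0 => by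
      linarith [le_abs_self (u x - ‖x‖), hR x hx h0])
    (C := C₀) (fun x hx => by
      have h := hbd x
      rw [hV' x hx] at h
      linarith [le_abs_self (u x - Real.sqrt (radSq x))])
    hf hf₁ hfbd hlim hode
  refine ⟨f, ?_, ?_, hlim, fun t => ⟨max_lt (hfbd t).1 (hfbd t).2.1, (hfbd t).2.2⟩, fun t => ?_,
    hu⟩
  · rw [show (2 : WithTop ℕ∞) = 1 + 1 by norm_num, contDiff_succ_iff_deriv, hdf,
      contDiff_one_iff_deriv, hdf₁]
    exact ⟨fun t => (hf t).differentiableAt, by simp, fun t => (hf₁ t).differentiableAt, hf₂⟩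
  · rwa [hdf, hdf₁]
  · have h0 : 0 ≤ 1 - f₁ t ^ 2 := by nlinarith [(hder t).1, (hder t).2.1]
    rw [hdf, hdf₁, ← Real.sqrt_eq_rpow, show (3 : ℝ) / 2 = (1 / 2) * (3 : ℕ) by norm_num,
      Real.rpow_mul_natCast h0, ← Real.sqrt_eq_rpow]
    exact hode t
end
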